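/- arXiv:2304.08395 — 12 statements merged into one kernel-verified Lean document; each statement's English description precedes it below -/
import Mathlib

section
/- There exists an integer N such that for every integer n ≥ N, the maximum over natural numbers t with 2n ≤ t ≤ ⌈3.6·n·ln(5n)⌉ of the squared absolute value of the (4n+1, 0) entry of the matrix power M_U^t is strictly greater than 1/(20n). -/
open Matrix

/-- The coin matrix `M_C = diag(1, R_A, …, R_A, R_A', …, R_A', 1)` (rows/columns
indexed by `0, …, 4n+1`), where `R_A = [[-1/3, 2√2/3], [2√2/3, 1/3]]` occupies the
index pairs `{2k-1, 2k}` for `k = 1, …, n` and `R_A' = [[1/3, 2√2/3], [2√2/3, -1/3]]`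
the pairs `{2k-1, 2k}` for `k = n+1, …, 2n`. -/
noncomputable def MC (n : ℕ) : Matrix (Fin (4*n+2)) (Fin (4*n+2)) ℝ :=
  Matrix.of fun i j =>
    if i = j then
      (if i.val = 0 ∨ i.val = 4*n+1 then 1
       else if i.val % 2 = 1 then (if i.val ≤ 2*n then -1/3 else 1/3)
       else (if i.val ≤ 2*n then 1/3 else -1/3))
    else if (i.val % 2 = 1 ∧ j.val = i.val + 1) ∨ (j.val % 2 = 1 ∧ i.val = j.val + 1) then
      2 * Real.sqrt 2 / 3
    else 0

/-- The shift matrix `M_S = diag(R_B, …, R_B)` with `2n+1` copies of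
`R_B = [[0,1],[1,0]]`, on the index pairs `{0,1}, {2,3}, …, {4n, 4n+1}`. -/
noncomputable def MS (n : ℕ) : Matrix (Fin (4*n+2)) (Fin (4*n+2)) ℝ :=
  Matrix.of fun i j => if i.val / 2 = j.val / 2 ∧ i ≠ j then 1 else 0

/-- The coined quantum walk matrix `M_U = M_S · M_C`. -/
noncomputable def MU (n : ℕ) : Matrix (Fin (4*n+2)) (Fin (4*n+2)) ℝ := MS n * MC n

/-- The involution of the index set exchanging `2m` and `2m+1`. -/
def shiftPartner (n : ℕ) (k : Fin (4*n+2)) : Fin (4*n+2) :=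
  ⟨if k.val % 2 = 0 then k.val + 1 else k.val - 1, by split_ifs <;> omega⟩

/-- The involution of the index set exchanging `2m-1` and `2m` and fixing both ends. -/
def coinPartner (n : ℕ) (k : Fin (4*n+2)) : Fin (4*n+2) :=
  ⟨if k.val = 0 ∨ k.val = 4*n+1 then k.val
    else if k.val % 2 = 1 then k.val + 1 else k.val - 1, by split_ifs <;> omega⟩

/-- The diagonal of `MC n`. -/
noncomputable def coinDiag (n : ℕ) (k : Fin (4*n+2)) : ℝ :=
  if k.val = 0 ∨ k.val = 4*n+1 then 1
    else if k.val % 2 = 1 then (if k.val ≤ 2*n then -1/3 else 1/3)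
    else (if k.val ≤ 2*n then 1/3 else -1/3)

/-- The off-diagonal entry of column `k` of `MC n`. -/
noncomputable def coinOff (n : ℕ) (k : Fin (4*n+2)) : ℝ :=
  if k.val = 0 ∨ k.val = 4*n+1 then 0 else 2 * Real.sqrt 2 / 3

lemma shiftPartner_involutive (n : ℕ) : Function.Involutive (shiftPartner n) := by
  intro k
  ext
  simp only [shiftPartner]
  split_ifs <;> omega

lemma coinPartner_involutive (n : ℕ) : Function.Involutive (coinPartner n) := by
  intro k
  ext
  by_cases hk : k.val = 0 ∨ k.val = 4*n+1
  · simp only [coinPartner, hk, if_true]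
  · by_cases h1 : k.val % 2 = 1
    · have h2 : ¬ (k.val + 1 = 0 ∨ k.val + 1 = 4*n+1) := by omega
      have h3 : ¬ (k.val + 1) % 2 = 1 := by omega
      simp only [coinPartner, hk, h1, h2, h3, if_true, if_false]
      omega
    · have h2 : ¬ (k.val - 1 = 0 ∨ k.val - 1 = 4*n+1) := by omega
      have h3 : (k.val - 1) % 2 = 1 := by omega
      simp only [coinPartner, hk, h1, h2, h3, if_true, if_false]
      omega

lemma MS_apply (n : ℕ) (i k : Fin (4*n+2)) :
    MS n i k = if i = shiftPartner n k then 1 else 0 := by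
  simp only [MS, shiftPartner, Matrix.of_apply, ne_eq, Fin.ext_iff]
  congr 1
  split_ifs <;> simp only [eq_iff_iff] <;> omega

lemma MC_apply (n : ℕ) (i k : Fin (4*n+2)) :
    MC n i k = (if i = k then coinDiag n k else 0) +
      (if i = coinPartner n k then coinOff n k else 0) := by
  simp only [MC, Matrix.of_apply]
  by_cases h : i = k
  · subst h
    by_cases hi : i.val = 0 ∨ i.val = 4*n+1
    · simp only [coinDiag, coinOff, hi, if_true, ite_self, add_zero]
    · have : i ≠ coinPartner n i := by
        simp only [coinPartner, ne_eq, Fin.ext_iff, hi, if_false]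
        split_ifs <;> omega
      simp [coinDiag, this]
  · have hik : i.val ≠ k.val := fun e => h (Fin.ext e)
    by_cases hk : k.val = 0 ∨ k.val = 4*n+1
    · have : ¬ ((i.val % 2 = 1 ∧ k.val = i.val + 1) ∨ (k.val % 2 = 1 ∧ i.val = k.val + 1)) := by
        omega
      simp only [coinOff, hk, h, this, if_true, if_false, ite_self, add_zero]
    · simp only [h, if_false, coinOff, hk, coinPartner, Fin.ext_iff, zero_add]
      congr 1
      split_ifs <;> simp only [eq_iff_iff] <;> omega

lemma MS_mul_self (n : ℕ) : MS n * MS n = 1 := by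
  ext i k
  simp [Matrix.mul_apply, MS_apply, Matrix.one_apply, shiftPartner_involutive n k]

lemma MS_transpose (n : ℕ) : (MS n)ᵀ = MS n := by
  ext i k
  simp only [Matrix.transpose_apply, MS_apply]
  congr 1
  rw [eq_iff_iff]
  constructor
  · rintro rfl; exact (shiftPartner_involutive n i).symm
  · rintro rfl; exact (shiftPartner_involutive n k).symm

lemma coinOff_coinPartner (n : ℕ) (k : Fin (4*n+2)) :
    coinOff n (coinPartner n k) = coinOff n k := by
  by_cases hk : k.val = 0 ∨ k.val = 4*n+1
  · simp only [coinOff, coinPartner, hk, if_true]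
  · have h : ¬ ((coinPartner n k).val = 0 ∨ (coinPartner n k).val = 4*n+1) := by
      by_cases h1 : k.val % 2 = 1
      · simp only [coinPartner, hk, h1, if_true, if_false]
        omega
      · simp only [coinPartner, hk, h1, if_false]
        omega
    simp only [coinOff, hk, h, if_false]

lemma coinOff_mul_coinDiag (n : ℕ) (k : Fin (4*n+2)) :
    coinOff n k * coinDiag n (coinPartner n k) = - (coinOff n k * coinDiag n k) := by
  by_cases hk : k.val = 0 ∨ k.val = 4*n+1
  · simp only [coinOff, hk, if_true, zero_mul, neg_zero]
  · by_cases h1 : k.val % 2 = 1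
    · have h2 : ¬ (k.val + 1 = 0 ∨ k.val + 1 = 4*n+1) := by omega
      have h3 : ¬ (k.val + 1) % 2 = 1 := by omega
      have h4 : k.val + 1 ≤ 2*n ↔ k.val ≤ 2*n := by omega
      simp only [coinOff, coinDiag, coinPartner, hk, h1, h2, h3, h4, if_true, if_false]
      split_ifs <;> ring
    · have h2 : ¬ (k.val - 1 = 0 ∨ k.val - 1 = 4*n+1) := by omega
      have h3 : (k.val - 1) % 2 = 1 := by omega
      have h4 : k.val - 1 ≤ 2*n ↔ k.val ≤ 2*n := by omega
      simp only [coinOff, coinDiag, coinPartner, hk, h1, h2, h3, h4, if_true, if_false]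
      split_ifs <;> ring

lemma coinDiag_sq_add_coinOff_sq (n : ℕ) (k : Fin (4*n+2)) :
    coinDiag n k ^ 2 + coinOff n k ^ 2 = 1 := by
  have h2 : Real.sqrt 2 ^ 2 = 2 := Real.sq_sqrt (by norm_num)
  simp only [coinDiag, coinOff]
  split_ifs <;> nlinarith

lemma MC_mul_self (n : ℕ) : MC n * MC n = 1 := by
  ext i k
  have h : (MC n * MC n) i k =
      MC n i k * coinDiag n k + MC n i (coinPartner n k) * coinOff n k := by
    rw [Matrix.mul_apply]
    simp only [MC_apply n _ k, mul_add, Finset.sum_add_distrib, mul_ite, mul_zero,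
      Finset.sum_ite_eq', Finset.mem_univ, if_true]
  rw [h, MC_apply, MC_apply, coinPartner_involutive n k, coinOff_coinPartner, Matrix.one_apply]
  have h1 := coinDiag_sq_add_coinOff_sq n k
  have h2 := coinOff_mul_coinDiag n k
  split_ifs <;> linarith

lemma MC_transpose (n : ℕ) : (MC n)ᵀ = MC n := by
  ext i k
  simp only [Matrix.transpose_apply, MC_apply]
  by_cases h : i = k
  · rw [h]
  · have h' : k ≠ i := fun e => h e.symm
    by_cases h2 : i = coinPartner n k
    · have h3 : k = coinPartner n i := by rw [h2, coinPartner_involutive n k]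
      simp only [h, h', ← h2, ← h3, if_true, if_false]
      rw [h2, coinOff_coinPartner]
    · have h3 : k ≠ coinPartner n i := fun e => h2 (by rw [e, coinPartner_involutive n i])
      simp [h, h', h2, h3]

lemma MU_mem_unitaryGroup (n : ℕ) : MU n ∈ Matrix.unitaryGroup (Fin (4*n+2)) ℝ := by
  rw [Matrix.mem_unitaryGroup_iff, Matrix.star_eq_conjTranspose,
    Matrix.conjTranspose_eq_transpose_of_trivial, MU, Matrix.transpose_mul, MS_transpose,
    MC_transpose, Matrix.mul_assoc, ← Matrix.mul_assoc (MC n), MC_mul_self, Matrix.one_mul,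
    MS_mul_self]

lemma abs_MU_pow_apply_le_one (n t : ℕ) (i j : Fin (4*n+2)) : |(MU n ^ t) i j| ≤ 1 :=
  entry_norm_bound_of_unitary (pow_mem (MU_mem_unitaryGroup n) t) i j

/-- The row vector `y` times `MU n`. -/
lemma sum_mul_MU (n : ℕ) (y : Fin (4*n+2) → ℂ) (j : Fin (4*n+2)) :
    ∑ i, y i * (MU n i j : ℂ) = y (shiftPartner n j) * coinDiag n j +
      y (shiftPartner n (coinPartner n j)) * coinOff n j := by
  have h : ∀ i, (MU n i j : ℂ) = ∑ k, (MS n i k : ℂ) * (MC n k j : ℂ) := by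
    intro i
    rw [MU, Matrix.mul_apply]
    push_cast
    rfl
  simp only [h, Finset.mul_sum]
  rw [Finset.sum_comm]
  have hS : ∀ i k, (MS n i k : ℂ) = if i = shiftPartner n k then 1 else 0 := by
    intro i k
    rw [MS_apply]
    split_ifs <;> simp
  have hC : ∀ k, (MC n k j : ℂ) = (if k = j then (coinDiag n j : ℂ) else 0) +
      (if k = coinPartner n j then (coinOff n j : ℂ) else 0) := by
    intro k
    rw [MC_apply]
    split_ifs <;> simp
  have h2 : ∀ k, ∑ i, y i * ((MS n i k : ℂ) * (MC n k j : ℂ)) =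
      y (shiftPartner n k) * (MC n k j : ℂ) := by
    intro k
    simp [hS]
  rw [Finset.sum_congr rfl fun k _ => h2 k]
  simp only [hC, mul_add, Finset.sum_add_distrib]
  simp

/-- The walk moves by at most one vertex of the path per step. -/
lemma MU_pow_apply_zero_eq_zero (n t : ℕ) {i j : Fin (4*n+2)} (hj : j.val = 0)
    (hi : 2*t < i.val) : (MU n ^ t) i j = 0 := by
  induction t generalizing i with
  | zero =>
    rw [pow_zero, Matrix.one_apply, if_neg]
    rintro rfl
    omega
  | succ t ih =>
    rw [pow_succ', MU, Matrix.mul_assoc, Matrix.mul_apply]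
    apply Finset.sum_eq_zero
    intro k _
    rw [MS_apply]
    split_ifs with h
    · rw [one_mul, Matrix.mul_apply]
      apply Finset.sum_eq_zero
      intro l _
      by_cases hl : 2*t < l.val
      · rw [← MU, ih hl, mul_zero]
      · rw [Fin.ext_iff] at h
        simp only [shiftPartner] at h
        have h1 : k ≠ l := fun e => by
          rw [e] at h
          split_ifs at h <;> omega
        have h2 : k ≠ coinPartner n l := fun e => by
          have e' := congrArg Fin.val e
          simp only [coinPartner] at e'
          split_ifs at h e' <;> omega
        simp [MC_apply, h1, h2]
    · rw [zero_mul]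

/-- The discrete energy of a solution of `a (k+2) = w * a (k+1) - a k`, with `X = re w`. -/
noncomputable def energy (X : ℝ) (a b : ℂ) : ℝ :=
  b.re ^ 2 + b.im ^ 2 + (a.re ^ 2 + a.im ^ 2) - X * (b.re * a.re + b.im * a.im)

lemma mul_abs_im_le_energy {X D : ℝ} (hD : D ^ 2 = 4 - X ^ 2) (a b : ℂ) :
    D * |b.im * a.re - b.re * a.im| ≤ energy X a b := by
  unfold energy
  rcases abs_cases (b.im * a.re - b.re * a.im) with ⟨h, -⟩ | ⟨h, -⟩ <;> rw [h]
  · nlinarith [sq_nonneg (b.re - (X / 2 * a.re - D / 2 * a.im)),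
      sq_nonneg (b.im - (X / 2 * a.im + D / 2 * a.re))]
  · nlinarith [sq_nonneg (b.re - (X / 2 * a.re + D / 2 * a.im)),
      sq_nonneg (b.im - (X / 2 * a.im - D / 2 * a.re))]

lemma energy_nonneg {X : ℝ} (hX : X ^ 2 ≤ 4) (a b : ℂ) : 0 ≤ energy X a b := by
  unfold energy
  nlinarith [sq_nonneg (b.re - X / 2 * a.re), sq_nonneg (b.im - X / 2 * a.im),
    mul_nonneg (sub_nonneg.2 hX) (sq_nonneg a.re), mul_nonneg (sub_nonneg.2 hX) (sq_nonneg a.im)]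

lemma energy_succ_le {w : ℂ} {D y : ℝ} (hD0 : 0 ≤ D) (hD : D ^ 2 = 4 - w.re ^ 2)
    (hY : |w.im| ≤ y * D) (hy : 0 ≤ y) (a b : ℂ) :
    (1 - y) * energy w.re b (w * b - a) ≤ (1 + y) * energy w.re a b := by
  have h1 := mul_abs_im_le_energy hD b (w * b - a)
  have h2 := mul_abs_im_le_energy hD a b
  set i1 := (w * b - a).im * b.re - (w * b - a).re * b.im with hi1
  set i2 := b.im * a.re - b.re * a.im with hi2
  have hdiff : energy w.re b (w * b - a) - energy w.re a b = w.im * (i1 + i2) := by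
    simp only [energy, hi1, hi2, Complex.sub_re, Complex.sub_im, Complex.mul_re, Complex.mul_im]
    ring
  have h3 : w.im * (i1 + i2) ≤ y * (D * |i1|) + y * (D * |i2|) := by
    calc w.im * (i1 + i2) ≤ |w.im * (i1 + i2)| := le_abs_self _
      _ = |w.im| * |i1 + i2| := abs_mul _ _
      _ ≤ (y * D) * (|i1| + |i2|) := by
          gcongr
          exact abs_add_le _ _
      _ = _ := by ring
  nlinarith [mul_le_mul_of_nonneg_left h1 hy, mul_le_mul_of_nonneg_left h2 hy]

lemma energy_le_pow {w : ℂ} {D y : ℝ} (hD0 : 0 ≤ D) (hD : D ^ 2 = 4 - w.re ^ 2)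
    (hY : |w.im| ≤ y * D) (hy : 0 ≤ y) (hy1 : y < 1) {a : ℕ → ℂ}
    (ha : ∀ k, a (k + 2) = w * a (k + 1) - a k) (k : ℕ) :
    energy w.re (a k) (a (k + 1)) ≤ ((1 + y) / (1 - y)) ^ k * energy w.re (a 0) (a 1) := by
  induction k with
  | zero => simp
  | succ k ih =>
    have h := energy_succ_le hD0 hD hY hy (a k) (a (k + 1))
    rw [← ha k] at h
    have hp : 0 < 1 - y := by linarith
    calc energy w.re (a (k + 1)) (a (k + 1 + 1))
        ≤ (1 + y) / (1 - y) * energy w.re (a k) (a (k + 1)) := by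
          rw [div_mul_eq_mul_div, le_div_iff₀ hp]
          linarith
      _ ≤ (1 + y) / (1 - y) * (((1 + y) / (1 - y)) ^ k * energy w.re (a 0) (a 1)) := by
          gcongr
      _ = _ := by ring

lemma weighted_norm_sq_le_energy {X : ℝ} (hX : X ^ 2 ≤ 51 / 125) (a b : ℂ) :
    ‖a‖ ^ 2 + ‖b‖ ^ 2 / 2 ≤ 61 / 50 * energy X a b := by
  have key : ∀ p q : ℝ, 0 ≤ 11 / 50 * p ^ 2 + 18 / 25 * q ^ 2 - 61 / 50 * X * (q * p) := by
    intro p q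
    nlinarith [sq_nonneg (q - 61 / 72 * X * p), mul_nonneg (sub_nonneg.2 hX) (sq_nonneg p),
      sq_nonneg p]
  rw [Complex.sq_norm, Complex.sq_norm, Complex.normSq_apply, Complex.normSq_apply, energy]
  linarith [key a.re b.re, key a.im b.im]

lemma norm_sq_le_energy {X : ℝ} (hX : X ^ 2 ≤ 51 / 125) (a b : ℂ) :
    ‖a‖ ^ 2 ≤ 2 * energy X a b := by
  have := energy_nonneg (hX.trans (by norm_num)) a b
  nlinarith [weighted_norm_sq_le_energy hX a b, sq_nonneg ‖b‖]

lemma energy_le_norm_sq {X : ℝ} (hX : X ^ 2 ≤ 4) (a b : ℂ) :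
    energy X a b ≤ 2 * (‖a‖ ^ 2 + ‖b‖ ^ 2) := by
  rw [Complex.sq_norm, Complex.sq_norm, Complex.normSq_apply, Complex.normSq_apply, energy]
  nlinarith [sq_nonneg (b.re + X / 2 * a.re), sq_nonneg (b.im + X / 2 * a.im),
    mul_nonneg (sub_nonneg.2 hX) (sq_nonneg a.re), mul_nonneg (sub_nonneg.2 hX) (sq_nonneg a.im)]

/-- Parseval's identity on a half period for trigonometric polynomials with real coefficients. -/
lemma integral_norm_sq_trigonometric (b : ℕ → ℝ) (L : ℕ) :
    ∫ φ in (0 : ℝ)..Real.pi, ‖∑ t ∈ Finset.range L, (b t : ℂ) * Complex.exp (t * φ * Complex.I)‖ ^ 2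
      = Real.pi * ∑ t ∈ Finset.range L, b t ^ 2 := by
  have h1 : ∀ φ : ℝ, ‖∑ t ∈ Finset.range L, (b t : ℂ) * Complex.exp (t * φ * Complex.I)‖ ^ 2 =
      ∑ t ∈ Finset.range L, ∑ u ∈ Finset.range L,
        b t * b u * Real.cos (((t : ℝ) - u) * φ) := by
    intro φ
    have hre : ∀ t : ℕ, ((b t : ℂ) * Complex.exp (t * φ * Complex.I)).re
        = b t * Real.cos (t * φ) := by
      intro t
      rw [Complex.re_ofReal_mul, ← Complex.ofReal_natCast, ← Complex.ofReal_mul,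
        Complex.exp_ofReal_mul_I_re]
    have him : ∀ t : ℕ, ((b t : ℂ) * Complex.exp (t * φ * Complex.I)).im
        = b t * Real.sin (t * φ) := by
      intro t
      rw [Complex.im_ofReal_mul, ← Complex.ofReal_natCast, ← Complex.ofReal_mul,
        Complex.exp_ofReal_mul_I_im]
    rw [Complex.sq_norm, Complex.normSq_apply, Complex.re_sum, Complex.im_sum]
    simp only [hre, him, Finset.sum_mul_sum, ← Finset.sum_add_distrib]
    refine Finset.sum_congr rfl fun t _ => Finset.sum_congr rfl fun u _ => ?_
    rw [sub_mul, Real.cos_sub]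
    ring
  have h2 : ∀ t u : ℕ, ∫ φ in (0 : ℝ)..Real.pi, b t * b u * Real.cos (((t : ℝ) - u) * φ) =
      if t = u then Real.pi * b t ^ 2 else 0 := by
    intro t u
    split_ifs with h
    · subst h
      simp
      ring
    · have h0 : (t : ℝ) - u ≠ 0 := sub_ne_zero.2 (by exact_mod_cast h)
      have h3 : Real.sin (((t : ℝ) - u) * Real.pi) = 0 := by
        have := Real.sin_int_mul_pi ((t : ℤ) - u)
        push_cast at this
        exact this
      rw [intervalIntegral.integral_const_mul, intervalIntegral.integral_comp_mul_left _ h0,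
        integral_cos, h3]
      simp
  simp only [h1]
  rw [intervalIntegral.integral_finsetSum]
  · rw [Finset.mul_sum]
    refine Finset.sum_congr rfl fun t ht => ?_
    rw [intervalIntegral.integral_finsetSum]
    · simp only [h2]
      rw [Finset.sum_ite_eq, if_pos ht]
    · intro u _
      exact Continuous.intervalIntegrable (by fun_prop) _ _
  · intro t _
    exact Continuous.intervalIntegrable (by fun_prop) _ _

lemma sum_sq_ge_of_norm_ge (b : ℕ → ℝ) (L : ℕ) {m α β : ℝ} (hm : 0 ≤ m) (hα : 0 ≤ α) (hαβ : α ≤ β)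
    (hβ : β ≤ Real.pi)
    (h : ∀ φ ∈ Set.Icc α β,
      m ≤ ‖∑ t ∈ Finset.range L, (b t : ℂ) * Complex.exp (t * φ * Complex.I)‖) :
    (β - α) * m ^ 2 ≤ Real.pi * ∑ t ∈ Finset.range L, b t ^ 2 := by
  rw [← integral_norm_sq_trigonometric]
  have hc : Continuous fun φ : ℝ =>
      ‖∑ t ∈ Finset.range L, (b t : ℂ) * Complex.exp (t * φ * Complex.I)‖ ^ 2 := by fun_prop
  calc (β - α) * m ^ 2 = ∫ _ in α..β, m ^ 2 := by simp
    _ ≤ ∫ φ in α..β, ‖∑ t ∈ Finset.range L, (b t : ℂ) * Complex.exp (t * φ * Complex.I)‖ ^ 2 := by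
        apply intervalIntegral.integral_mono_on hαβ (by simp) (hc.intervalIntegrable _ _)
        intro φ hφ
        exact pow_le_pow_left₀ hm (h φ hφ) 2
    _ ≤ _ := by
        apply intervalIntegral.integral_mono_interval hα hαβ hβ _ (hc.intervalIntegrable _ _)
        exact Filter.Eventually.of_forall fun φ => by positivity

/-- Edge amplitudes listed in the order of the index set: `u 0, v 0, u 1, v 1, …`. -/
def interleave (u v : ℕ → ℂ) (j : ℕ) : ℂ := if j % 2 = 0 then u (j / 2) else v (j / 2)

/-- `interleave u v`, with the two amplitudes of every edge exchanged. -/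
def swappedInterleave (n : ℕ) (u v : ℕ → ℂ) (i : Fin (4*n+2)) : ℂ :=
  interleave u v (shiftPartner n i).val

/-- The off-diagonal coin entry, and the sine of the coin angle. -/
noncomputable def coinSin : ℂ := ((2 * Real.sqrt 2 / 3 : ℝ) : ℂ)

/-- The signed cosine of the coin angle at the vertex joining edges `k` and `k+1`. -/
noncomputable def coinCos (n k : ℕ) : ℂ := if k < n then 1 / 3 else -1 / 3

lemma coinSin_sq : coinSin ^ 2 = 8 / 9 := by
  have h2 : Real.sqrt 2 ^ 2 = 2 := Real.sq_sqrt (by norm_num)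
  rw [coinSin, ← Complex.ofReal_pow, div_pow, mul_pow, h2]
  norm_num

lemma coinSin_ne_zero : coinSin ≠ 0 := by
  intro h
  have := coinSin_sq
  rw [h] at this
  norm_num at this

lemma swappedInterleave_mul_MU {n : ℕ} {z : ℂ} {u v : ℕ → ℂ} (h0 : v 0 = z * u 0)
    (hu : ∀ k < 2*n, u k = z * (coinSin * u (k + 1) - coinCos n k * v k))
    (hv : ∀ k < 2*n, v (k + 1) = z * (coinSin * v k + coinCos n k * u (k + 1)))
    (j : Fin (4*n+2)) :
    swappedInterleave n u v j - z * ∑ i, swappedInterleave n u v i * (MU n i j : ℂ) =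
      if j.val = 4*n+1 then u (2*n) - z * v (2*n) else 0 := by
  rw [sum_mul_MU]
  simp only [swappedInterleave, shiftPartner_involutive n _]
  by_cases hj0 : j.val = 0
  · simp [coinDiag, coinOff, hj0, shiftPartner, interleave, h0]
  by_cases hj1 : j.val = 4*n+1
  · have e1 : (4*n+1) % 2 = 1 := by omega
    have e2 : (4*n+1) / 2 = 2*n := by omega
    have e3 : 4*n/2 = 2*n := by omega
    have e4 : 4*n % 2 = 0 := by omega
    simp [coinDiag, coinOff, hj1, shiftPartner, interleave, e1, e2, e3, e4]
  have hj : ¬ (j.val = 0 ∨ j.val = 4*n+1) := by omega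
  rw [if_neg hj1]
  by_cases hodd : j.val % 2 = 1
  · obtain ⟨k, hk⟩ : ∃ k, j.val = 2*k+1 := ⟨j.val / 2, by omega⟩
    have hk2 : k < 2*n := by omega
    have hd : (coinDiag n j : ℂ) = - coinCos n k := by
      by_cases hkn : k < n
      · have : j.val ≤ 2*n := by omega
        simp only [coinDiag, hj, hodd, this, coinCos, hkn, if_true, if_false]
        norm_num
      · have : ¬ j.val ≤ 2*n := by omega
        simp only [coinDiag, hj, hodd, this, coinCos, hkn, if_true, if_false]
        norm_num
    have ho : (coinOff n j : ℂ) = coinSin := by simp only [coinOff, hj, if_false, coinSin]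
    have w1 : interleave u v (shiftPartner n j).val = u k := by
      have e : (shiftPartner n j).val = 2*k := by
        have : ¬ j.val % 2 = 0 := by omega
        simp only [shiftPartner, this, if_false]
        omega
      rw [e, interleave, if_pos (by omega)]
      congr 1; omega
    have w2 : interleave u v j.val = v k := by
      rw [interleave, if_neg (by omega)]
      congr 1; omega
    have w3 : interleave u v (coinPartner n j).val = u (k+1) := by
      have e : (coinPartner n j).val = 2*k+2 := by
        simp only [coinPartner, hj, hodd, if_true, if_false]
        omega
      rw [e, interleave, if_pos (by omega)]
      congr 1; omega
    rw [hd, ho, w1, w2, w3]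
    linear_combination hu k hk2
  · obtain ⟨k, hk⟩ : ∃ k, j.val = 2*k+2 := ⟨j.val / 2 - 1, by omega⟩
    have hk2 : k < 2*n := by omega
    have hd : (coinDiag n j : ℂ) = coinCos n k := by
      by_cases hkn : k < n
      · have : j.val ≤ 2*n := by omega
        simp only [coinDiag, hj, hodd, this, coinCos, hkn, if_true, if_false]
        norm_num
      · have : ¬ j.val ≤ 2*n := by omega
        simp only [coinDiag, hj, hodd, this, coinCos, hkn, if_false]
        norm_num
    have ho : (coinOff n j : ℂ) = coinSin := by simp only [coinOff, hj, if_false, coinSin]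
    have w1 : interleave u v (shiftPartner n j).val = v (k+1) := by
      have e : (shiftPartner n j).val = 2*k+3 := by
        have : j.val % 2 = 0 := by omega
        simp only [shiftPartner, this, if_true]
        omega
      rw [e, interleave, if_neg (by omega)]
      congr 1; omega
    have w2 : interleave u v j.val = u (k+1) := by
      rw [interleave, if_pos (by omega)]
      congr 1; omega
    have w3 : interleave u v (coinPartner n j).val = v k := by
      have e : (coinPartner n j).val = 2*k+1 := by
        simp only [coinPartner, hj, hodd, if_false]
        omega
      rw [e, interleave, if_neg (by omega)]
      congr 1; omega
    rw [hd, ho, w1, w2, w3]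
    linear_combination hv k hk2

/-- The truncated generating function of the corner entries of the powers of `MU n`. -/
lemma corner_generating_function {n : ℕ} {z : ℂ} {u v : ℕ → ℂ} (hu0 : u 0 = 1) (hv0 : v 0 = z)
    (hu : ∀ k < 2*n, u k = z * (coinSin * u (k + 1) - coinCos n k * v k))
    (hv : ∀ k < 2*n, v (k + 1) = z * (coinSin * v k + coinCos n k * u (k + 1)))
    {j₀ j₁ : Fin (4*n+2)} (h₀ : j₀.val = 0) (h₁ : j₁.val = 4*n+1) (L : ℕ) :
    (u (2*n) - z * v (2*n)) * ∑ t ∈ Finset.range L,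
        z ^ t * (((MU n ^ t) j₁ j₀ : ℝ) : ℂ) =
      z - z ^ L * ∑ i, swappedInterleave n u v i * (((MU n ^ L) i j₀ : ℝ) : ℂ) := by
  induction L with
  | zero =>
    have h : ∀ i : Fin (4*n+2), (((1 : Matrix (Fin (4*n+2)) (Fin (4*n+2)) ℝ) i j₀ : ℝ) : ℂ)
        = if i = j₀ then 1 else 0 := by
      intro i
      rw [Matrix.one_apply]
      split_ifs <;> simp
    simp only [pow_zero, h, Finset.range_zero, Finset.sum_empty, mul_zero, one_mul, mul_ite,
      mul_one, Finset.sum_ite_eq', Finset.mem_univ, if_true]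
    simp [swappedInterleave, shiftPartner, interleave, h₀, hv0]
  | succ L ih =>
    have hpow : ∀ i : Fin (4*n+2), (((MU n ^ (L + 1)) i j₀ : ℝ) : ℂ) =
        ∑ j, (MU n i j : ℂ) * (((MU n ^ L) j j₀ : ℝ) : ℂ) := by
      intro i
      rw [pow_succ', Matrix.mul_apply]
      push_cast
      rfl
    have hstep : ∑ i, swappedInterleave n u v i * (((MU n ^ L) i j₀ : ℝ) : ℂ) -
        z * ∑ i, swappedInterleave n u v i * (((MU n ^ (L + 1)) i j₀ : ℝ) : ℂ) =
        (u (2*n) - z * v (2*n)) * (((MU n ^ L) j₁ j₀ : ℝ) : ℂ) := by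
      simp only [hpow, Finset.mul_sum]
      rw [Finset.sum_comm, ← Finset.sum_sub_distrib]
      have hterm : ∀ j : Fin (4*n+2),
          swappedInterleave n u v j * (((MU n ^ L) j j₀ : ℝ) : ℂ) -
            ∑ i, z * (swappedInterleave n u v i *
              ((MU n i j : ℂ) * (((MU n ^ L) j j₀ : ℝ) : ℂ))) =
          if j = j₁ then
            (u (2*n) - z * v (2*n)) * (((MU n ^ L) j j₀ : ℝ) : ℂ) else 0 := by
        intro j
        have h := swappedInterleave_mul_MU (by rw [hu0, hv0, mul_one]) hu hv j
        have e : ∑ i, z * (swappedInterleave n u v i *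
              ((MU n i j : ℂ) * (((MU n ^ L) j j₀ : ℝ) : ℂ))) =
            z * (∑ i, swappedInterleave n u v i * (MU n i j : ℂ)) *
              (((MU n ^ L) j j₀ : ℝ) : ℂ) := by
          rw [Finset.mul_sum, Finset.sum_mul]
          exact Finset.sum_congr rfl fun i _ => by ring
        rw [e, ← sub_mul, h]
        simp only [Fin.ext_iff, h₁]
        split_ifs <;> simp
      rw [Finset.sum_congr rfl fun j _ => hterm j]
      simp
    rw [Finset.sum_range_succ, mul_add, ih, pow_succ]
    linear_combination (-z ^ L) * hstep

lemma norm_sum_swappedInterleave_le {n : ℕ} {u v : ℕ → ℂ} {B : ℝ}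
    (hu : ∀ k ≤ 2*n, ‖u k‖ ≤ B) (hv : ∀ k ≤ 2*n, ‖v k‖ ≤ B) (j : Fin (4*n+2))
    (L : ℕ) :
    ‖∑ i, swappedInterleave n u v i * (((MU n ^ L) i j : ℝ) : ℂ)‖ ≤ (4*n+2) * B := by
  have hB : ∀ i, ‖swappedInterleave n u v i‖ ≤ B := by
    intro i
    have : (shiftPartner n i).val / 2 ≤ 2*n := by
      have := (shiftPartner n i).isLt
      omega
    rw [swappedInterleave, interleave]
    split_ifs
    · exact hu _ this
    · exact hv _ this
  have hB0 : 0 ≤ B := (norm_nonneg _).trans (hu 0 (by omega))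
  calc _ ≤ ∑ _i : Fin (4*n+2), B := by
        refine norm_sum_le_of_le _ fun i _ => ?_
        rw [norm_mul, Complex.norm_real, Real.norm_eq_abs]
        calc _ ≤ B * 1 := by
              gcongr
              · exact hB i
              · exact abs_MU_pow_apply_le_one n L i _
          _ = B := mul_one B
    _ = _ := by simp

/-- Transfer of the amplitudes on one edge to the next edge, at a vertex of coin angle cosine `τ`. -/
noncomputable def edgeStep (τ z : ℂ) (x : ℂ × ℂ) : ℂ × ℂ :=
  ((x.1 * z⁻¹ + τ * x.2) * coinSin⁻¹, (τ * x.1 + z * x.2) * coinSin⁻¹)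

lemma inv_coinSin_sq : (coinSin⁻¹) ^ 2 = 9 / 8 := by
  rw [inv_pow, coinSin_sq]
  norm_num

lemma edgeStep_backward {τ z : ℂ} (hτ : τ ^ 2 = 1 / 9) (hz : z ≠ 0) (x : ℂ × ℂ) :
    x.1 = z * (coinSin * (edgeStep τ z x).1 - τ * x.2) ∧
      (edgeStep τ z x).2 = z * (coinSin * x.2 + τ * (edgeStep τ z x).1) := by
  have hs := coinSin_sq
  have hs0 := coinSin_ne_zero
  simp only [edgeStep]
  constructor
  · field_simp
    ring
  · field_simp
    linear_combination (-z * x.2) * hτ - z * x.2 * hs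

lemma edgeStep_edgeStep {τ z : ℂ} (hτ : τ ^ 2 = 1 / 9) (hz : z ≠ 0) (x : ℂ × ℂ) :
    (edgeStep τ z (edgeStep τ z x)).1 =
        (z + z⁻¹) * coinSin⁻¹ * (edgeStep τ z x).1 - x.1 ∧
      (edgeStep τ z (edgeStep τ z x)).2 =
        (z + z⁻¹) * coinSin⁻¹ * (edgeStep τ z x).2 - x.2 := by
  have hs := inv_coinSin_sq
  have hzi : z * z⁻¹ = 1 := mul_inv_cancel₀ hz
  simp only [edgeStep]
  constructor
  · linear_combination (coinSin⁻¹) ^ 2 * x.1 * hτ - (coinSin⁻¹) ^ 2 * x.1 * hzi - 8 / 9 * x.1 * hs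
  · linear_combination (coinSin⁻¹) ^ 2 * x.2 * hτ - (coinSin⁻¹) ^ 2 * x.2 * hzi - 8 / 9 * x.2 * hs

lemma iterate_edgeStep_recurrence {τ z : ℂ} (hτ : τ ^ 2 = 1 / 9) (hz : z ≠ 0) (x : ℂ × ℂ) (k : ℕ) :
    ((edgeStep τ z)^[k + 2] x).1 = (z + z⁻¹) * coinSin⁻¹ * ((edgeStep τ z)^[k + 1] x).1 -
        ((edgeStep τ z)^[k] x).1 ∧
      ((edgeStep τ z)^[k + 2] x).2 = (z + z⁻¹) * coinSin⁻¹ * ((edgeStep τ z)^[k + 1] x).2 -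
        ((edgeStep τ z)^[k] x).2 := by
  simp only [Function.iterate_succ_apply']
  exact edgeStep_edgeStep hτ hz _

lemma iterate_edgeStep_adjoint (τ z : ℂ) (n : ℕ) (x y : ℂ × ℂ) :
    ((edgeStep τ z)^[n] x).1 * y.1 - ((edgeStep τ z)^[n] x).2 * y.2 =
      x.1 * ((edgeStep (-τ) z)^[n] y).1 - x.2 * ((edgeStep (-τ) z)^[n] y).2 := by
  induction n generalizing y with
  | zero => rfl
  | succ n ih =>
    rw [Function.iterate_succ_apply', Function.iterate_succ_apply, ← ih]
    simp only [edgeStep]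
    ring

/-- The amplitudes on all edges of the path, started from `(1, z)` on the first edge. -/
noncomputable def edgeAmplitude (n : ℕ) (z : ℂ) (k : ℕ) : ℂ × ℂ :=
  if k ≤ n then (edgeStep (1 / 3) z)^[k] (1, z)
  else (edgeStep (-(1 / 3)) z)^[k - n] ((edgeStep (1 / 3) z)^[n] (1, z))

lemma edgeAmplitude_succ (n : ℕ) (z : ℂ) (k : ℕ) :
    edgeAmplitude n z (k + 1) = edgeStep (coinCos n k) z (edgeAmplitude n z k) := by
  unfold edgeAmplitude coinCos
  rcases lt_trichotomy k n with h | h | h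
  · rw [if_pos h, if_pos (show k + 1 ≤ n by omega), if_pos h.le, Function.iterate_succ_apply']
  · subst h
    rw [if_neg (by omega), if_pos le_rfl, if_neg (by omega), Nat.add_sub_cancel_left, neg_div]
    rfl
  · rw [if_neg (by omega), if_neg (by omega), if_neg (by omega),
      show k + 1 - n = (k - n) + 1 by omega, Function.iterate_succ_apply', neg_div]

lemma edgeAmplitude_end (n : ℕ) (z : ℂ) :
    (edgeAmplitude n z (2*n)).1 - z * (edgeAmplitude n z (2*n)).2 =
      ((edgeStep (1 / 3) z)^[n] (1, z)).1 ^ 2 - ((edgeStep (1 / 3) z)^[n] (1, z)).2 ^ 2 := by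
  have h : edgeAmplitude n z (2*n) =
      (edgeStep (-(1 / 3)) z)^[n] ((edgeStep (1 / 3) z)^[n] (1, z)) := by
    unfold edgeAmplitude
    rcases Nat.eq_zero_or_pos n with rfl | h
    · rfl
    · rw [if_neg (by omega), show 2*n - n = n by omega]
  rw [h]
  have := iterate_edgeStep_adjoint (1 / 3) z n (1, z) ((edgeStep (1 / 3) z)^[n] (1, z))
  linear_combination -this

lemma norm_inv_coinSin_le : ‖coinSin⁻¹‖ ≤ 9 / 8 := by
  have h : ‖coinSin⁻¹‖ ^ 2 = 9 / 8 := by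
    rw [← norm_pow, inv_coinSin_sq]
    norm_num
  nlinarith [norm_nonneg coinSin⁻¹]

section Bounds

variable {z : ℂ} {D y : ℝ}

lemma norm_iterate_edgeStep_le {τ : ℂ} (hτ : τ ^ 2 = 1 / 9) (hτ' : ‖τ‖ ≤ 1 / 3) (hz : z ≠ 0)
    (hz1 : ‖z‖ ≤ 1) (hz2 : ‖z⁻¹‖ ≤ 2) (hX : ((z + z⁻¹) * coinSin⁻¹).re ^ 2 ≤ 51 / 125)
    (hD0 : 0 ≤ D) (hD : D ^ 2 = 4 - ((z + z⁻¹) * coinSin⁻¹).re ^ 2)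
    (hY : |((z + z⁻¹) * coinSin⁻¹).im| ≤ y * D) (hy : 0 ≤ y) (hy1 : y < 1) {n : ℕ}
    (hR : ((1 + y) / (1 - y)) ^ n ≤ 1250) {x : ℂ × ℂ} {B : ℝ} (h1 : ‖x.1‖ ≤ B) (h2 : ‖x.2‖ ≤ B)
    {k : ℕ} (hk : k ≤ n) :
    ‖((edgeStep τ z)^[k] x).1‖ ≤ 250 * B ∧ ‖((edgeStep τ z)^[k] x).2‖ ≤ 250 * B := by
  have hB : 0 ≤ B := (norm_nonneg _).trans h1
  have hs := norm_inv_coinSin_le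
  have hRk : ((1 + y) / (1 - y)) ^ k ≤ 1250 := by
    refine (pow_le_pow_right₀ ?_ hk).trans hR
    rw [le_div_iff₀ (by linarith)]
    linarith
  have general : ∀ a : ℕ → ℂ, (∀ k, a (k + 2) = (z + z⁻¹) * coinSin⁻¹ * a (k + 1) - a k) →
      ‖a 0‖ ≤ B → ‖a 1‖ ≤ 3 * B → ‖a k‖ ≤ 250 * B := by
    intro a ha h0 h1
    have e1 := norm_sq_le_energy hX (a k) (a (k + 1))
    have e2 := energy_le_pow hD0 hD hY hy hy1 ha k
    have e3 := energy_le_norm_sq (hX.trans (by norm_num)) (a 0) (a 1)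
    have e4 := energy_nonneg (hX.trans (by norm_num)) (a 0) (a 1)
    have e5 : ‖a 0‖ ^ 2 ≤ B ^ 2 := by gcongr
    have e6 : ‖a 1‖ ^ 2 ≤ (3 * B) ^ 2 := by gcongr
    have e7 := mul_le_mul_of_nonneg_right hRk e4
    refine abs_le_of_sq_le_sq' ?_ (by positivity) |>.2
    nlinarith
  have step1 : ‖(edgeStep τ z x).1‖ ≤ 3 * B := by
    calc ‖(x.1 * z⁻¹ + τ * x.2) * coinSin⁻¹‖ ≤ (‖x.1‖ * ‖z⁻¹‖ + ‖τ‖ * ‖x.2‖) * ‖coinSin⁻¹‖ := by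
          rw [norm_mul]
          gcongr
          exact (norm_add_le _ _).trans (by rw [norm_mul, norm_mul])
      _ ≤ (B * 2 + 1 / 3 * B) * (9 / 8) := by gcongr
      _ ≤ 3 * B := by linarith
  have step2 : ‖(edgeStep τ z x).2‖ ≤ 3 * B := by
    calc ‖(τ * x.1 + z * x.2) * coinSin⁻¹‖ ≤ (‖τ‖ * ‖x.1‖ + ‖z‖ * ‖x.2‖) * ‖coinSin⁻¹‖ := by
          rw [norm_mul]
          gcongr
          exact (norm_add_le _ _).trans (by rw [norm_mul, norm_mul])
      _ ≤ (1 / 3 * B + 1 * B) * (9 / 8) := by gcongr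
      _ ≤ 3 * B := by linarith
  exact ⟨general (fun k => ((edgeStep τ z)^[k] x).1)
      (fun k => (iterate_edgeStep_recurrence hτ hz x k).1) h1 step1,
    general (fun k => ((edgeStep τ z)^[k] x).2)
      (fun k => (iterate_edgeStep_recurrence hτ hz x k).2) h2 step2⟩

lemma norm_edgeAmplitude_le (hz : z ≠ 0)
    (hz1 : ‖z‖ ≤ 1) (hz2 : ‖z⁻¹‖ ≤ 2) (hX : ((z + z⁻¹) * coinSin⁻¹).re ^ 2 ≤ 51 / 125)
    (hD0 : 0 ≤ D) (hD : D ^ 2 = 4 - ((z + z⁻¹) * coinSin⁻¹).re ^ 2)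
    (hY : |((z + z⁻¹) * coinSin⁻¹).im| ≤ y * D) (hy : 0 ≤ y) (hy1 : y < 1) {n : ℕ}
    (hR : ((1 + y) / (1 - y)) ^ n ≤ 1250) {k : ℕ} (hk : k ≤ 2*n) :
    ‖(edgeAmplitude n z k).1‖ ≤ 62500 ∧ ‖(edgeAmplitude n z k).2‖ ≤ 62500 := by
  have first : ∀ j ≤ n, ‖((edgeStep (1 / 3) z)^[j] (1, z)).1‖ ≤ 250 * 1 ∧
      ‖((edgeStep (1 / 3) z)^[j] (1, z)).2‖ ≤ 250 * 1 := fun j hj =>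
    norm_iterate_edgeStep_le (by norm_num) (by norm_num) hz hz1 hz2 hX hD0 hD hY hy hy1 hR
      (by simp) (by simpa using hz1) hj
  unfold edgeAmplitude
  split_ifs with h
  · obtain ⟨a, b⟩ := first k h
    exact ⟨a.trans (by norm_num), b.trans (by norm_num)⟩
  · obtain ⟨a, b⟩ := first n le_rfl
    have := norm_iterate_edgeStep_le (τ := -(1 / 3)) (k := k - n) (by norm_num) (by norm_num) hz
      hz1 hz2 hX hD0 hD hY hy hy1 hR a b (by omega)
    exact ⟨this.1.trans (by norm_num), this.2.trans (by norm_num)⟩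

lemma norm_edgeAmplitude_end_le (hz : z ≠ 0)
    (hX : ((z + z⁻¹) * coinSin⁻¹).re ^ 2 ≤ 51 / 125)
    (hD0 : 0 ≤ D) (hD : D ^ 2 = 4 - ((z + z⁻¹) * coinSin⁻¹).re ^ 2)
    (hY : |((z + z⁻¹) * coinSin⁻¹).im| ≤ y * D) (hy : 0 ≤ y) (hy1 : y < 1) (n : ℕ) :
    ‖1 - z ^ 2‖ * ‖(edgeAmplitude n z (2*n)).1 - z * (edgeAmplitude n z (2*n)).2‖ ≤
      ‖z‖ ^ 2 * (61 / 50 * (((1 + y) / (1 - y)) ^ n *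
        (4 - 8 / 9 * ((z + z⁻¹) * coinSin⁻¹).re ^ 2 + 16 / 9 * ((z + z⁻¹) * coinSin⁻¹).im ^ 2))) := by
  set w := (z + z⁻¹) * coinSin⁻¹ with hw
  set x : ℕ → ℂ × ℂ := fun k => (edgeStep (1 / 3) z)^[k] (1, z) with hx
  set F : ℕ → ℂ := fun k => ((x k).2 + z * (x k).1) * z⁻¹ with hF
  have hzi : z * z⁻¹ = 1 := mul_inv_cancel₀ hz
  have hs := inv_coinSin_sq
  have hrec : ∀ k, F (k + 2) = w * F (k + 1) - F k := by
    intro k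
    obtain ⟨e1, e2⟩ := iterate_edgeStep_recurrence (τ := 1 / 3) (by norm_num) hz (1, z) k
    simp only [hF, hx, e1, e2]
    ring
  have hnext : ∀ k, F (k + 1) = 4 / 3 * coinSin⁻¹ * (((x k).1 + z * (x k).2) * z⁻¹) := by
    intro k
    simp only [hF, hx, Function.iterate_succ_apply', edgeStep]
    linear_combination
      (coinSin⁻¹ * z⁻¹ * ((edgeStep (1 / 3) z)^[k] (1, z)).1) * hzi
  have hF0 : F 0 = 2 := by
    simp only [hF, hx, Function.iterate_zero, id]
    linear_combination 2 * hzi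
  have hF1 : F 1 = 4 / 3 * w := by
    rw [hnext 0, hw]
    simp only [hx, Function.iterate_zero, id]
    linear_combination 4 / 3 * coinSin⁻¹ * z * hzi
  have hE0 : energy w.re (F 0) (F 1) = 4 - 8 / 9 * w.re ^ 2 + 16 / 9 * w.im ^ 2 := by
    rw [hF0, hF1]
    have e1 : (4 / 3 * w).re = 4 / 3 * w.re := by
      rw [show (4 / 3 : ℂ) = ((4 / 3 : ℝ) : ℂ) by norm_num, Complex.re_ofReal_mul]
    have e2 : (4 / 3 * w).im = 4 / 3 * w.im := by
      rw [show (4 / 3 : ℂ) = ((4 / 3 : ℝ) : ℂ) by norm_num, Complex.im_ofReal_mul]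
    simp only [energy, e1, e2, Complex.re_ofNat, Complex.im_ofNat]
    ring
  have hprod : (1 - z ^ 2) * ((x n).1 ^ 2 - (x n).2 ^ 2) =
      z ^ 2 * (F (n + 1) ^ 2 / 2 - F n ^ 2) := by
    rw [hnext n]
    simp only [hF]
    have e : z ^ 2 * (z⁻¹) ^ 2 = 1 := by rw [← mul_pow, hzi, one_pow]
    linear_combination (-(8 / 9) * z ^ 2 * ((x n).1 + z * (x n).2) ^ 2 * (z⁻¹) ^ 2) * hs +
      (((x n).2 + z * (x n).1) ^ 2 - ((x n).1 + z * (x n).2) ^ 2) * e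
  rw [edgeAmplitude_end, ← norm_mul, hprod, norm_mul, norm_pow]
  gcongr
  calc ‖F (n + 1) ^ 2 / 2 - F n ^ 2‖ ≤ ‖F n‖ ^ 2 + ‖F (n + 1)‖ ^ 2 / 2 := by
        refine (norm_sub_le _ _).trans ?_
        rw [norm_div, norm_pow, norm_pow, Complex.norm_ofNat, add_comm]
    _ ≤ 61 / 50 * energy w.re (F n) (F (n + 1)) := weighted_norm_sq_le_energy hX _ _
    _ ≤ 61 / 50 * (((1 + y) / (1 - y)) ^ n * energy w.re (F 0) (F 1)) := by
        gcongr
        exact energy_le_pow hD0 hD hY hy hy1 hrec n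
    _ = _ := by rw [hE0]

end Bounds

section SpectralParameter

variable {ε φ : ℝ}

lemma re_add_inv_exp (ε φ : ℝ) :
    (Complex.exp (-ε + φ * Complex.I) + (Complex.exp (-ε + φ * Complex.I))⁻¹).re =
      2 * Real.cosh ε * Real.cos φ := by
  rw [← Complex.exp_neg, Complex.add_re, Complex.exp_re, Complex.exp_re, Real.cosh_eq]
  simp
  ring

lemma im_add_inv_exp (ε φ : ℝ) :
    (Complex.exp (-ε + φ * Complex.I) + (Complex.exp (-ε + φ * Complex.I))⁻¹).im =
      -(2 * Real.sinh ε * Real.sin φ) := by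
  rw [← Complex.exp_neg, Complex.add_im, Complex.exp_im, Complex.exp_im, Real.sinh_eq]
  simp
  ring

lemma re_sq_mul_inv_coinSin (a : ℂ) : (a * coinSin⁻¹).re ^ 2 = 9 / 8 * a.re ^ 2 := by
  have h2 : Real.sqrt 2 ^ 2 = 2 := Real.sq_sqrt (by norm_num)
  rw [coinSin, ← Complex.ofReal_inv, Complex.re_mul_ofReal, mul_pow, inv_pow, div_pow, mul_pow, h2]
  ring

lemma im_sq_mul_inv_coinSin (a : ℂ) : (a * coinSin⁻¹).im ^ 2 = 9 / 8 * a.im ^ 2 := by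
  have h2 : Real.sqrt 2 ^ 2 = 2 := Real.sq_sqrt (by norm_num)
  rw [coinSin, ← Complex.ofReal_inv, Complex.im_mul_ofReal, mul_pow, inv_pow, div_pow, mul_pow, h2]
  ring

lemma norm_exp_spectral (ε φ : ℝ) : ‖Complex.exp (-ε + φ * Complex.I)‖ = Real.exp (-ε) := by
  rw [Complex.norm_exp]
  simp

lemma two_mul_sin_le_norm (hφ : 0 ≤ Real.sin φ) :
    Real.exp (-ε) * (2 * Real.sin φ) ≤ ‖1 - Complex.exp (-ε + φ * Complex.I) ^ 2‖ := by
  set z := Complex.exp (-ε + φ * Complex.I) with hz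
  have hz0 : z ≠ 0 := Complex.exp_ne_zero _
  have e : 1 - z ^ 2 = z * (z⁻¹ - z) := by
    rw [mul_sub, mul_inv_cancel₀ hz0]
    ring
  have him : (z⁻¹ - z).im = -(2 * Real.cosh ε * Real.sin φ) := by
    rw [hz, ← Complex.exp_neg, Complex.sub_im, Complex.exp_im, Complex.exp_im, Real.cosh_eq]
    simp
    ring
  rw [e, norm_mul, norm_exp_spectral]
  gcongr
  refine le_trans ?_ (Complex.abs_im_le_norm _)
  rw [him, abs_neg, abs_of_nonneg (by positivity)]
  nlinarith [Real.one_le_cosh ε]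

lemma sinh_sq_le (h0 : 0 ≤ ε) (h1 : ε ≤ 3 / 10000) :
    Real.sinh ε ^ 2 ≤ 10004 / 10000 * ε ^ 2 := by
  have e1 := abs_le.1 (Real.abs_exp_sub_one_sub_id_le (x := ε) (abs_le.2 ⟨by linarith, by linarith⟩))
  have e2 := Real.add_one_le_exp (-ε)
  have h2 : Real.sinh ε ≤ 100015 / 100000 * ε := by
    rw [Real.sinh_eq]
    nlinarith [e1.2]
  have h3 : 0 ≤ Real.sinh ε := Real.sinh_nonneg_iff.2 h0
  calc Real.sinh ε ^ 2 ≤ (100015 / 100000 * ε) ^ 2 := by gcongr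
    _ ≤ 10004 / 10000 * ε ^ 2 := by nlinarith [sq_nonneg ε]

lemma growth_le_exp {y : ℝ} (h0 : 0 ≤ y) (h1 : y ≤ 1 / 100) (n : ℕ) :
    ((1 + y) / (1 - y)) ^ n ≤ Real.exp (n * (101 / 50 * y)) := by
  have h : (1 + y) / (1 - y) ≤ Real.exp (101 / 50 * y) := by
    have e1 := Real.add_one_le_exp y
    have e2 := abs_le.1 (Real.abs_exp_sub_one_sub_id_le (x := -(51 / 50 * y))
      (abs_le.2 ⟨by linarith, by linarith⟩))
    have e3 : Real.exp (-(51 / 50 * y)) ≤ 1 - y := by nlinarith [e2.2]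
    have e4 : Real.exp (101 / 50 * y) * Real.exp (-(51 / 50 * y)) = Real.exp y := by
      rw [← Real.exp_add]
      ring_nf
    rw [div_le_iff₀ (by linarith)]
    nlinarith [Real.exp_pos (101 / 50 * y)]
  rw [Real.exp_nat_mul]
  exact pow_le_pow_left₀ (div_nonneg (by linarith) (by linarith)) h n

lemma spectral_bounds (hε0 : 0 ≤ ε) (hε1 : ε ≤ 3 / 10000) (hC : Real.cos φ ^ 2 ≤ 9 / 100)
    {w : ℂ} (hw : w = (Complex.exp (-ε + φ * Complex.I) +
      (Complex.exp (-ε + φ * Complex.I))⁻¹) * coinSin⁻¹) :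
    w.re ^ 2 ≤ 51 / 125 ∧ |w.im| ≤ 107 / 100 * ε * Real.sqrt (4 - w.re ^ 2) ∧
      4 - 8 / 9 * w.re ^ 2 + 16 / 9 * w.im ^ 2 ≤ 4004 / 1000 * Real.sin φ ^ 2 := by
  have hre : w.re ^ 2 = 9 / 2 * ((Real.sinh ε ^ 2 + 1) * Real.cos φ ^ 2) := by
    rw [hw, re_sq_mul_inv_coinSin, re_add_inv_exp, ← Real.cosh_sq]
    ring
  have him : w.im ^ 2 = 9 / 2 * (Real.sinh ε ^ 2 * (1 - Real.cos φ ^ 2)) := by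
    rw [hw, im_sq_mul_inv_coinSin, im_add_inv_exp, ← Real.sin_sq]
    ring
  have hsinh := sinh_sq_le hε0 hε1
  have hsinh0 := sq_nonneg (Real.sinh ε)
  have hC0 := sq_nonneg (Real.cos φ)
  have hεsq : ε ^ 2 ≤ 1 / 10000000 := by nlinarith
  rw [Real.sin_sq]
  generalize Real.sinh ε ^ 2 = q at *
  generalize Real.cos φ ^ 2 = c at *
  have hqc : q * c ≤ 10004 / 10000 * ε ^ 2 * (9 / 100) := by gcongr
  have hX : w.re ^ 2 ≤ 51 / 125 := by
    rw [hre]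
    linarith
  refine ⟨hX, abs_le_of_sq_le_sq ?_ (by positivity), ?_⟩
  · rw [mul_pow, Real.sq_sqrt (by linarith), him, hre]
    have h1 : q * (1 - c) ≤ 10004 / 10000 * ε ^ 2 * (1 - c) := by
      gcongr
      linarith
    have h2 : 0 ≤ ε ^ 2 * (9 / 100 - c) := mul_nonneg (sq_nonneg _) (by linarith)
    have h3 : ε ^ 2 * (q * c) ≤ ε ^ 2 * (1 / 10000000) := by
      gcongr
      linarith
    linarith [sq_nonneg ε]
  · rw [hre, him]
    have h1 : q * (1 - c) ≤ 1 / 2000 * (1 - c) := by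
      gcongr <;> linarith
    have h2 : 0 ≤ q * c := by positivity
    linarith

lemma exp_growth_bound_le : Real.exp (649 / 100) ≤ 1250 := by
  calc Real.exp (649 / 100) ≤ Real.exp ((7 : ℕ) * 1) := Real.exp_le_exp.2 (by norm_num)
    _ = Real.exp 1 ^ 7 := Real.exp_nat_mul 1 7
    _ ≤ 2.7182818286 ^ 7 := by
        gcongr
        exact Real.exp_one_lt_d9.le
    _ ≤ 1250 := by norm_num

lemma growth_le {n : ℕ} (hn : 10000 ≤ n) (hε : ε = 3 / n) :
    ((1 + 107 / 100 * ε) / (1 - 107 / 100 * ε)) ^ n ≤ Real.exp (649 / 100) := by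
  have hn' : (10000 : ℝ) ≤ n := by exact_mod_cast hn
  have hnpos : (0 : ℝ) < n := by linarith
  have hε0 : 0 ≤ ε := by rw [hε]; positivity
  have hε1 : ε ≤ 3 / 10000 := by
    rw [hε]
    gcongr
  refine (growth_le_exp (by positivity) (by linarith) n).trans (Real.exp_le_exp.2 ?_)
  have : (n : ℝ) * ε = 3 := by rw [hε]; field_simp
  linarith

lemma norm_edgeAmplitude_exp_end_le {n : ℕ} (hn : 10000 ≤ n) (hε : ε = 3 / n)
    (hC : Real.cos φ ^ 2 ≤ 9 / 100) (hS : 0 < Real.sin φ)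
    {z : ℂ} (hz : z = Complex.exp (-ε + φ * Complex.I)) :
    ‖(edgeAmplitude n z (2*n)).1 - z * (edgeAmplitude n z (2*n)).2‖ ≤
      489 / 200 * Real.exp (-ε) * Real.exp (649 / 100) := by
  have hn' : (10000 : ℝ) ≤ n := by exact_mod_cast hn
  have hε0 : 0 ≤ ε := by rw [hε]; positivity
  have hε1 : ε ≤ 3 / 10000 := by
    rw [hε]
    gcongr
  have hz0 : z ≠ 0 := by rw [hz]; exact Complex.exp_ne_zero _
  have hzn : ‖z‖ = Real.exp (-ε) := by rw [hz]; exact norm_exp_spectral ε φ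
  obtain ⟨hX, hY, h2⟩ := spectral_bounds (w := (z + z⁻¹) * coinSin⁻¹) hε0 hε1 hC (by rw [hz])
  have hend := norm_edgeAmplitude_end_le hz0 hX (Real.sqrt_nonneg _)
    (Real.sq_sqrt (by linarith)) hY (by positivity) (by linarith) n
  have hR := growth_le hn hε
  have h1 := two_mul_sin_le_norm (ε := ε) hS.le
  rw [← hz] at h1
  have hR0 : 0 ≤ ((1 + 107 / 100 * ε) / (1 - 107 / 100 * ε)) ^ n :=
    pow_nonneg (div_nonneg (by linarith) (by linarith)) n
  generalize ((1 + 107 / 100 * ε) / (1 - 107 / 100 * ε)) ^ n = R at *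
  generalize (edgeAmplitude n z (2*n)).1 - z * (edgeAmplitude n z (2*n)).2 = γ at *
  generalize 4 - 8 / 9 * ((z + z⁻¹) * coinSin⁻¹).re ^ 2 +
    16 / 9 * ((z + z⁻¹) * coinSin⁻¹).im ^ 2 = E at *
  generalize Real.exp (649 / 100) = M at *
  have h3 : R * E ≤ M * (4004 / 1000 * Real.sin φ ^ 2) :=
    (mul_le_mul_of_nonneg_left h2 hR0).trans (mul_le_mul_of_nonneg_right hR (by positivity))
  have hM : 0 ≤ M := hR0.trans hR
  have h4 : Real.exp (-ε) * (2 * Real.sin φ) * ‖γ‖ ≤ Real.exp (-ε) ^ 2 *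
      (61 / 50 * (M * (4004 / 1000 * Real.sin φ ^ 2))) := by
    calc _ ≤ ‖1 - z ^ 2‖ * ‖γ‖ := by gcongr
      _ ≤ _ := hend
      _ ≤ _ := by
        rw [hzn]
        gcongr
  have h5 : Real.exp (-ε) * (2 * Real.sin φ) * ‖γ‖ ≤ Real.exp (-ε) * (2 * Real.sin φ) *
      (61 / 50 * 2002 / 1000 * Real.exp (-ε) * M * Real.sin φ) := by
    linarith
  refine (le_of_mul_le_mul_left h5 (by positivity)).trans ?_
  calc _ ≤ 61 / 50 * 2002 / 1000 * Real.exp (-ε) * M * 1 := by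
        gcongr
        exact Real.sin_le_one φ
    _ ≤ _ := by
        have : 0 ≤ Real.exp (-ε) * M := by positivity
        linarith

lemma norm_edgeAmplitude_exp_le {n : ℕ} (hn : 10000 ≤ n) (hε : ε = 3 / n)
    (hC : Real.cos φ ^ 2 ≤ 9 / 100) {z : ℂ} (hz : z = Complex.exp (-ε + φ * Complex.I))
    {k : ℕ} (hk : k ≤ 2*n) :
    ‖(edgeAmplitude n z k).1‖ ≤ 62500 ∧ ‖(edgeAmplitude n z k).2‖ ≤ 62500 := by
  have hn' : (10000 : ℝ) ≤ n := by exact_mod_cast hn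
  have hε0 : 0 ≤ ε := by rw [hε]; positivity
  have hε1 : ε ≤ 3 / 10000 := by
    rw [hε]
    gcongr
  have hz0 : z ≠ 0 := by rw [hz]; exact Complex.exp_ne_zero _
  have hzn : ‖z‖ = Real.exp (-ε) := by rw [hz]; exact norm_exp_spectral ε φ
  obtain ⟨hX, hY, -⟩ := spectral_bounds (w := (z + z⁻¹) * coinSin⁻¹) hε0 hε1 hC (by rw [hz])
  have hr2 := Real.add_one_le_exp (-ε)
  have hz2 : ‖z⁻¹‖ ≤ 2 := by
    rw [norm_inv, hzn]
    exact inv_le_of_inv_le₀ (by norm_num) (by linarith)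
  exact norm_edgeAmplitude_le hz0 (hzn.trans_le (Real.exp_le_one_iff.2 (by linarith))) hz2 hX
    (Real.sqrt_nonneg _) (Real.sq_sqrt (by linarith)) hY (by positivity) (by linarith)
    ((growth_le hn hε).trans exp_growth_bound_le) hk

lemma edgeAmplitude_backward (n : ℕ) {z : ℂ} (hz : z ≠ 0) (k : ℕ) :
    (edgeAmplitude n z k).1 = z * (coinSin * (edgeAmplitude n z (k + 1)).1 -
        coinCos n k * (edgeAmplitude n z k).2) ∧
      (edgeAmplitude n z (k + 1)).2 = z * (coinSin * (edgeAmplitude n z k).2 +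
        coinCos n k * (edgeAmplitude n z (k + 1)).1) := by
  have hτ : coinCos n k ^ 2 = 1 / 9 := by
    unfold coinCos
    split_ifs <;> norm_num
  rw [edgeAmplitude_succ]
  exact edgeStep_backward hτ hz _

/-- Lower bound for the truncated generating function, close to the band centre. -/
lemma norm_corner_sum_ge {n L : ℕ} (hn : 10000 ≤ n) (hε : ε = 3 / n)
    (hC : Real.cos φ ^ 2 ≤ 9 / 100) (hS : 0 < Real.sin φ)
    (hL : Real.exp (-ε) ^ L * ((4*n+2) * 62500) ≤ 1 / 100 * Real.exp (-ε))
    {j₀ j₁ : Fin (4*n+2)} (h₀ : j₀.val = 0) (h₁ : j₁.val = 4*n+1) :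
    2 / 5 * Real.exp (-(649 / 100)) ≤
      ‖∑ t ∈ Finset.range L, Complex.exp (-ε + φ * Complex.I) ^ t *
        (((MU n ^ t) j₁ j₀ : ℝ) : ℂ)‖ := by
  obtain ⟨z, hz⟩ : ∃ z, z = Complex.exp (-ε + φ * Complex.I) := ⟨_, rfl⟩
  rw [← hz]
  have hz0 : z ≠ 0 := by rw [hz]; exact Complex.exp_ne_zero _
  have hzn : ‖z‖ = Real.exp (-ε) := by rw [hz]; exact norm_exp_spectral ε φ
  have hinit : edgeAmplitude n z 0 = (1, z) := by simp [edgeAmplitude]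
  have hgen := corner_generating_function (n := n) (z := z)
    (u := fun k => (edgeAmplitude n z k).1) (v := fun k => (edgeAmplitude n z k).2)
    (by simp [hinit]) (by simp [hinit]) (fun k _ => (edgeAmplitude_backward n hz0 k).1)
    (fun k _ => (edgeAmplitude_backward n hz0 k).2) h₀ h₁ L
  have hrem := norm_sum_swappedInterleave_le (n := n)
    (u := fun k => (edgeAmplitude n z k).1) (v := fun k => (edgeAmplitude n z k).2)
    (fun k hk => (norm_edgeAmplitude_exp_le hn hε hC hz hk).1)
    (fun k hk => (norm_edgeAmplitude_exp_le hn hε hC hz hk).2) j₀ L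
  have hγ := norm_edgeAmplitude_exp_end_le hn hε hC hS hz
  have hlow := norm_sub_norm_le z (z ^ L * ∑ i, swappedInterleave n
    (fun k => (edgeAmplitude n z k).1) (fun k => (edgeAmplitude n z k).2) i *
      (((MU n ^ L) i j₀ : ℝ) : ℂ))
  rw [← hgen, norm_mul, norm_mul, norm_pow, hzn] at hlow
  have hr0 := Real.exp_pos (-ε)
  have h2 := (mul_le_mul_of_nonneg_left hrem (pow_nonneg hr0.le L)).trans hL
  rw [Real.exp_neg, ← div_eq_mul_inv, div_le_iff₀ (Real.exp_pos _)]
  have h3 := mul_le_mul_of_nonneg_right hγ (norm_nonneg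
    (∑ t ∈ Finset.range L, z ^ t * (((MU n ^ t) j₁ j₀ : ℝ) : ℂ)))
  generalize ‖∑ t ∈ Finset.range L, z ^ t *
    (((MU n ^ t) j₁ j₀ : ℝ) : ℂ)‖ = G at *
  have h4 : Real.exp (-ε) * (99 / 100) ≤
      Real.exp (-ε) * (489 / 200 * (Real.exp (649 / 100) * G)) := by
    linarith
  have h5 := le_of_mul_le_mul_left h4 hr0
  linarith

end SpectralParameter

/-- There exists `N` such that for every `n ≥ N`, the maximum over
`t ∈ [2n, ⌈3.6 n log(5n)⌉]` of `|(M_U^t)_{4n+1,0}|²` is `> 1/(20n)`. -/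
theorem stmt0 :
    ∃ N : ℕ, ∀ n : ℕ, N ≤ n →
      ∃ t : ℕ, 2*n ≤ t ∧ (t : ℤ) ≤ ⌈(3.6 : ℝ) * n * Real.log (5*n)⌉ ∧
        |((MU n) ^ t) ⟨4*n+1, by omega⟩ ⟨0, by omega⟩| ^ 2 > 1 / (20 * (n : ℝ)) := by
  refine ⟨10000, fun n hn => ?_⟩
  by_contra! hcon
  have hn' : (10000 : ℝ) ≤ n := by exact_mod_cast hn
  have hnpos : (0 : ℝ) < n := by linarith
  have hlog : 0 ≤ Real.log (5*n) := Real.log_nonneg (by linarith)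
  obtain ⟨T, hT⟩ : ∃ T : ℕ, (T : ℤ) = ⌈(3.6 : ℝ) * n * Real.log (5*n)⌉ :=
    Int.eq_ofNat_of_zero_le (Int.ceil_nonneg (by positivity)) |>.imp fun _ h => h.symm
  have hT' : (3.6 : ℝ) * n * Real.log (5*n) ≤ T := by
    have := Int.le_ceil ((3.6 : ℝ) * n * Real.log (5*n))
    rw [← hT] at this
    exact_mod_cast this
  set ε : ℝ := 3 / n with hε
  set r := Real.exp (-ε) with hr
  have hr0 : 0 < r := Real.exp_pos _
  have hε0 : 0 < ε := by positivity
  have hr1 : r < 1 := Real.exp_lt_one_iff.2 (by linarith)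
  have hL : r ^ (T + 1) * ((4*n+2) * 62500) ≤ 1 / 100 * r := by
    have h1 : r ^ T ≤ 1 / (5 * n) ^ 3 := by
      calc r ^ T = Real.exp (T * (-ε)) := (Real.exp_nat_mul _ _).symm
        _ ≤ Real.exp (-((3 : ℕ) * Real.log (5*n))) := by
            apply Real.exp_le_exp.2
            have : ε * (3.6 * n * Real.log (5*n)) = 10.8 * Real.log (5*n) := by
              rw [hε]
              field_simp
              ring
            push_cast
            nlinarith [mul_le_mul_of_nonneg_left hT' hε0.le]
        _ = 1 / (5 * n) ^ 3 := by
            rw [Real.exp_neg, Real.exp_nat_mul, Real.exp_log (by positivity), one_div]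
    have h2 : 1 / (5 * (n : ℝ)) ^ 3 * ((4*n+2) * 62500) ≤ 1 / 100 := by
      rw [div_mul_eq_mul_div, div_le_iff₀ (by positivity)]
      nlinarith [mul_le_mul hn' hn' (by norm_num) hnpos.le]
    calc r ^ (T + 1) * ((4*n+2) * 62500) = r ^ T * ((4*n+2) * 62500) * r := by ring
      _ ≤ 1 / (5 * (n : ℝ)) ^ 3 * ((4*n+2) * 62500) * r := by gcongr
      _ ≤ 1 / 100 * r := by gcongr
  set a : ℕ → ℝ := fun t => (MU n ^ t) ⟨4*n+1, by omega⟩ ⟨0, by omega⟩ with ha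
  have hpi := Real.pi_gt_three
  have hlower := sum_sq_ge_of_norm_ge (fun t => r ^ t * a t) (T + 1)
    (m := 2 / 5 * Real.exp (-(649 / 100))) (α := Real.pi / 2 - 3 / 10)
    (β := Real.pi / 2 + 3 / 10) (by positivity) (by linarith) (by linarith) (by linarith) (by
      intro φ hφ
      have hcos : Real.cos φ ^ 2 ≤ 9 / 100 := by
        have h1 : Real.cos φ = Real.sin (Real.pi / 2 - φ) := (Real.sin_pi_div_two_sub φ).symm
        have h2 : |Real.sin (Real.pi / 2 - φ)| ≤ 3 / 10 :=
          (Real.abs_sin_le_abs (x := Real.pi / 2 - φ)).trans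
            (abs_le.2 ⟨by linarith [hφ.2], by linarith [hφ.1]⟩)
        rw [h1, ← sq_abs]
        nlinarith [abs_nonneg (Real.sin (Real.pi / 2 - φ))]
      have hsin : 0 < Real.sin φ :=
        Real.sin_pos_of_pos_of_lt_pi (by linarith [hφ.1]) (by linarith [hφ.2])
      refine (norm_corner_sum_ge (j₀ := ⟨0, by omega⟩) (j₁ := ⟨4*n+1, by omega⟩) hn hε hcos hsin hL
        rfl rfl).trans_eq ?_
      congr 1
      refine Finset.sum_congr rfl fun t _ => ?_
      have e : Complex.exp (-ε + φ * Complex.I) ^ t =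
          ((r ^ t : ℝ) : ℂ) * Complex.exp (t * φ * Complex.I) := by
        rw [Complex.exp_add, mul_pow, ← Complex.exp_nat_mul (φ * Complex.I), hr]
        push_cast
        ring_nf
      rw [e]
      push_cast
      ring)
  have hupper : ∑ t ∈ Finset.range (T + 1), (r ^ t * a t) ^ 2 ≤
      Real.exp (-12) * (1 / 120 + 1 / (20 * n)) := by
    have hr2 : r ^ 2 < 1 := pow_lt_one₀ hr0.le hr1 (by norm_num)
    calc ∑ t ∈ Finset.range (T + 1), (r ^ t * a t) ^ 2
        = ∑ t ∈ Finset.Ico (2*n) (T + 1), (r ^ t * a t) ^ 2 := by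
          refine (Finset.sum_subset ?_ ?_).symm
          · intro t ht
            simp only [Finset.mem_Ico, Finset.mem_range] at *
            omega
          · intro t ht ht'
            simp only [Finset.mem_Ico, Finset.mem_range] at *
            have : a t = 0 := MU_pow_apply_zero_eq_zero n t rfl (show 2*t < 4*n+1 by omega)
            simp [this]
      _ ≤ ∑ t ∈ Finset.Ico (2*n) (T + 1), (r ^ 2) ^ t * (1 / (20 * n)) := by
          refine Finset.sum_le_sum fun t ht => ?_
          rw [Finset.mem_Ico] at ht
          have := hcon t ht.1 (by rw [← hT]; exact_mod_cast Nat.lt_succ_iff.1 ht.2)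
          rw [sq_abs] at this
          rw [mul_pow, ← pow_mul, mul_comm t 2, pow_mul]
          gcongr
      _ = (∑ t ∈ Finset.Ico (2*n) (T + 1), (r ^ 2) ^ t) * (1 / (20 * n)) := by
          rw [Finset.sum_mul]
      _ ≤ (r ^ 2) ^ (2*n) / (1 - r ^ 2) * (1 / (20 * n)) := by
          gcongr
          exact geom_sum_Ico_le_of_lt_one (by positivity) hr2
      _ ≤ Real.exp (-12) * (n / 6 + 1) * (1 / (20 * n)) := by
          gcongr
          have e1 : (r ^ 2) ^ (2*n) = Real.exp (-12) := by
            rw [← pow_mul, hr, ← Real.exp_nat_mul, hε]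
            congr 1
            push_cast
            field_simp
            ring
          have e2 : r ^ 2 * Real.exp (6 / n) = 1 := by
            rw [hr, ← Real.exp_nat_mul, ← Real.exp_add, hε, Real.exp_eq_one_iff]
            push_cast
            ring
          have e3 := Real.add_one_le_exp (6 / (n : ℝ))
          have e4 : r ^ 2 * (6 / n + 1) ≤ 1 := by
            calc r ^ 2 * (6 / n + 1) ≤ r ^ 2 * Real.exp (6 / n) := by gcongr
              _ = 1 := e2
          rw [e1, div_le_iff₀ (by linarith), mul_assoc]
          refine le_mul_of_one_le_right (Real.exp_pos _).le ?_
          have e5 : (n / 6 + 1 : ℝ) = n / 6 * (6 / n + 1) := by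
            field_simp
            ring
          have e6 : (n / 6 : ℝ) * (r ^ 2 * (6 / n + 1)) ≤ n / 6 * 1 := by gcongr
          rw [mul_sub, e5]
          have e7 : (n / 6 : ℝ) * (6 / n + 1) = n / 6 + 1 := e5.symm
          linarith
      _ = _ := by
          field_simp
          ring
  have hE : Real.exp (-12) ≤ 2.7182818286 * Real.exp (-(649 / 100)) ^ 2 := by
    calc Real.exp (-12) ≤ Real.exp (1 + (2 : ℕ) * -(649 / 100)) :=
          Real.exp_le_exp.2 (by norm_num)
      _ = Real.exp 1 * Real.exp (-(649 / 100)) ^ 2 := by rw [Real.exp_add, Real.exp_nat_mul]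
      _ ≤ _ := by
          gcongr
          exact Real.exp_one_lt_d9.le
  have hsmall : 1 / (20 * (n : ℝ)) ≤ 1 / 200000 := by
    apply one_div_le_one_div_of_le <;> linarith
  have hfin : Real.pi * ∑ t ∈ Finset.range (T + 1), (r ^ t * a t) ^ 2 ≤
      3.15 * (2.7182818286 * Real.exp (-(649 / 100)) ^ 2 * (1 / 120 + 1 / 200000)) := by
    have hpi' := Real.pi_lt_d2
    calc _ ≤ Real.pi * (Real.exp (-12) * (1 / 120 + 1 / (20 * n))) := by gcongr
      _ ≤ _ := by gcongr
  have hpos : 0 < Real.exp (-(649 / 100)) ^ 2 := by positivity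
  have := hlower.trans hfin
  nlinarith
end

section
/- Let θ₀ = arctan(√3/(√2−1)). There exists an integer N such that for all n ≥ N: whenever θ ∈ (π/3, 2π/3) is an ε-root and θ' ∈ (0, π) is an ε'-root with θ' ≠ θ (for any signs ε, ε' ∈ {+1, −1}), one has |θ − θ'| ≥ (π − 2θ₀)/n. -/
open Real

/-- With `p = 1/3`, `q = 2/3`, call `θ ∈ (0,π)` an `ε`-root (`ε = ±1`) if
`√q·sin((n+1)θ) + ε·√p·sin(nθ) = 0`. -/
def IsRoot (n : ℕ) (ε θ : ℝ) : Prop :=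
  Real.sqrt (2/3) * Real.sin ((n+1) * θ) + ε * Real.sqrt (1/3) * Real.sin (n * θ) = 0

lemma IsRoot.sqrt_two_mul_sin_add {n : ℕ} {ε θ : ℝ} (h : IsRoot n ε θ) :
    √2 * sin ((n + 1) * θ) + ε * sin (n * θ) = 0 := by
  unfold IsRoot at h
  have h3 : √(2 / 3) = √2 * √(1 / 3) := by
    rw [← Real.sqrt_mul (by norm_num)]
    norm_num
  have hpos : 0 < √(1 / 3 : ℝ) := Real.sqrt_pos.mpr (by norm_num)
  rw [h3] at h
  refine mul_left_cancel₀ hpos.ne' ?_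
  linear_combination h

lemma sqrt_two_gt : (1.41 : ℝ) < √2 := Real.lt_sqrt_of_sq_lt (by norm_num)

lemma sqrt_two_lt : √2 < 1.42 := by
  rw [Real.sqrt_lt' (by norm_num)]
  norm_num

lemma half_lt_cos_of_abs_lt {x : ℝ} (hx : |x| < π / 3) : 1 / 2 < cos x := by
  rw [← Real.cos_abs x, ← Real.cos_pi_div_three]
  exact Real.cos_lt_cos_of_nonneg_of_le_pi (abs_nonneg x) (by linarith [Real.pi_pos]) hx

lemma pi_sub_two_mul_arctan_lt : π - 2 * arctan (√3 / (√2 - 1)) < π / 3 := by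
  have h : π / 3 < arctan (√3 / (√2 - 1)) := by
    rw [← Real.arctan_tan (x := π / 3) (by linarith [Real.pi_pos]) (by linarith [Real.pi_pos]),
      Real.tan_pi_div_three]
    apply Real.arctan_strictMono
    rw [lt_div_iff₀ (by linarith [sqrt_two_gt])]
    have : 0 < √(3 : ℝ) := by positivity
    nlinarith [sqrt_two_lt]
  linarith

/-- Squared modulus of `√2 exp(i a) + ε exp(i b)` when its imaginary part vanishes. -/
lemma sq_sqrt_two_mul_cos_add {a b ε : ℝ} (hε : ε = 1 ∨ ε = -1)
    (h : √2 * sin a + ε * sin b = 0) :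
    (√2 * cos a + ε * cos b) ^ 2 = 3 + 2 * √2 * ε * cos (a - b) := by
  have h2 : √(2 : ℝ) ^ 2 = 2 := Real.sq_sqrt (by norm_num)
  have hε2 : ε ^ 2 = 1 := by rcases hε with rfl | rfl <;> norm_num
  rw [Real.cos_sub]
  linear_combination (-(√2 * sin a + ε * sin b)) * h + (sin a ^ 2 + cos a ^ 2) * h2
    + (sin b ^ 2 + cos b ^ 2) * hε2 + 2 * Real.sin_sq_add_cos_sq a + Real.sin_sq_add_cos_sq b

lemma abs_sqrt_two_mul_cos_add_ge {a b ε : ℝ} (hε : ε = 1 ∨ ε = -1)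
    (h : √2 * sin a + ε * sin b = 0) : 0.4 ≤ |√2 * cos a + ε * cos b| := by
  have hsq := sq_sqrt_two_mul_cos_add hε h
  refine abs_le_of_sq_le_sq' ?_ (abs_nonneg _) |>.2
  rw [sq_abs, hsq]
  have := sqrt_two_gt
  have := sqrt_two_lt
  rcases hε with rfl | rfl
  · nlinarith [Real.neg_one_le_cos (a - b)]
  · nlinarith [Real.cos_le_one (a - b)]

lemma abs_sqrt_two_mul_cos_add_le {a b ε : ℝ} (hε : ε = 1 ∨ ε = -1) :
    |√2 * cos a + ε * cos b| ≤ 2.42 := by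
  have := sqrt_two_gt
  have := sqrt_two_lt
  rw [abs_le]
  rcases hε with rfl | rfl <;> constructor <;>
    nlinarith [Real.neg_one_le_cos a, Real.cos_le_one a, Real.neg_one_le_cos b, Real.cos_le_one b]

lemma pi_div_three_le_of_same_sign {n : ℕ} (hn : 100 ≤ n) {ε θ θ' : ℝ} (hε : ε = 1 ∨ ε = -1)
    (h : √2 * sin ((n + 1) * θ) + ε * sin (n * θ) = 0)
    (h' : √2 * sin ((n + 1) * θ') + ε * sin (n * θ') = 0) (hlt : θ < θ') :
    π / 3 ≤ n * (θ' - θ) := by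
  by_contra! hd
  have hn' : (100 : ℝ) ≤ n := by exact_mod_cast hn
  let f : ℝ → ℝ := fun x ↦ √2 * sin ((n + 1) * x) + ε * sin (n * x)
  have hderiv (x : ℝ) : HasDerivAt f
      (√2 * (cos ((n + 1) * x) * (n + 1)) + ε * (cos (n * x) * n)) x := by
    have h1 := (((hasDerivAt_id x).const_mul ((n : ℝ) + 1)).sin.const_mul √2).add
      (((hasDerivAt_id x).const_mul (n : ℝ)).sin.const_mul ε)
    simpa [f, Pi.add_def] using! h1
  obtain ⟨ξ, ⟨hξ1, hξ2⟩, hξ⟩ := exists_hasDerivAt_eq_zero hlt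
    (fun x _ ↦ (hderiv x).continuousAt.continuousWithinAt) (h.trans h'.symm)
    (fun x _ ↦ hderiv x)
  set δ := n * (ξ - θ) with hδ
  have hδ0 : 0 ≤ δ := by nlinarith
  have hδ1 : δ < π / 3 := by nlinarith
  have hcos := half_lt_cos_of_abs_lt (x := δ) (by rwa [abs_of_nonneg hδ0])
  have hP := abs_sqrt_two_mul_cos_add_ge hε h
  have hshift : √2 * cos ((n + 1) * θ + δ) + ε * cos (n * θ + δ)
      = (√2 * cos ((n + 1) * θ) + ε * cos (n * θ)) * cos δ := by
    rw [Real.cos_add, Real.cos_add]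
    linear_combination (-sin δ) * h
  have hb : n * θ + δ = n * ξ := by rw [hδ]; ring
  have hclose : |cos ((n + 1) * ξ) - cos ((n + 1) * θ + δ)| ≤ ξ - θ := by
    have := Real.abs_cos_sub_cos_le ((n + 1) * ξ) ((n + 1) * θ + δ)
    rwa [show (n + 1) * ξ - ((n + 1) * θ + δ) = ξ - θ by rw [hδ]; ring,
      abs_of_pos (sub_pos.mpr hξ1)] at this
  rw [hb] at hshift
  have hkey : n * ((√2 * cos ((n + 1) * θ) + ε * cos (n * θ)) * cos δ)
      = -√2 * (cos ((n + 1) * ξ) + n * (cos ((n + 1) * ξ) - cos ((n + 1) * θ + δ))) := by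
    rw [← hshift]
    linear_combination hξ
  have hupper : |cos ((n + 1) * ξ) + n * (cos ((n + 1) * ξ) - cos ((n + 1) * θ + δ))|
      ≤ 1 + δ := by
    refine (abs_add_le _ _).trans (add_le_add (Real.abs_cos_le_one _) ?_)
    rw [abs_mul, Nat.abs_cast]
    exact mul_le_mul_of_nonneg_left hclose (Nat.cast_nonneg n)
  have habs := congrArg abs hkey
  rw [abs_mul, abs_mul, abs_mul, abs_neg, Nat.abs_cast, abs_of_pos (by linarith : 0 < cos δ),
    abs_of_nonneg (Real.sqrt_nonneg 2)] at habs
  have hR : √2 * |cos ((n + 1) * ξ) + n * (cos ((n + 1) * ξ) - cos ((n + 1) * θ + δ))|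
      ≤ 1.42 * 3 :=
    mul_le_mul sqrt_two_lt.le (by linarith [Real.pi_lt_four]) (abs_nonneg _) (by norm_num)
  have hL : 100 * (0.4 * (1 / 2)) ≤
      n * (|√2 * cos ((n + 1) * θ) + ε * cos (n * θ)| * cos δ) := by
    gcongr
  linarith

lemma pi_div_three_le_of_opposite_sign {n : ℕ} (hn : 100 ≤ n) {ε θ θ' : ℝ}
    (hε : ε = 1 ∨ ε = -1) (hθ : √3 / 2 ≤ sin θ)
    (h : √2 * sin ((n + 1) * θ) + ε * sin (n * θ) = 0)
    (h' : √2 * sin ((n + 1) * θ') - ε * sin (n * θ') = 0) :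
    π / 3 ≤ n * |θ' - θ| := by
  by_contra! hd
  have hn' : (100 : ℝ) ≤ n := by exact_mod_cast hn
  have h2 : √(2 : ℝ) ^ 2 = 2 := Real.sq_sqrt (by norm_num)
  have hε2 : ε ^ 2 = 1 := by rcases hε with rfl | rfl <;> norm_num
  set δ := n * (θ' - θ) with hδ
  set R := √2 * cos ((n + 1) * θ) + ε * cos (n * θ) with hR
  have hδabs : |δ| = n * |θ' - θ| := by rw [hδ, abs_mul, Nat.abs_cast]
  have hcos := half_lt_cos_of_abs_lt (x := δ) (by rwa [hδabs])
  have hclose : |sin ((n + 1) * θ + δ) - sin ((n + 1) * θ')| ≤ |θ' - θ| := by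
    have := Real.abs_sin_sub_sin_le ((n + 1) * θ + δ) ((n + 1) * θ')
    rwa [show (n + 1) * θ + δ - (n + 1) * θ' = -(θ' - θ) by rw [hδ]; ring, abs_neg] at this
  have hb : n * θ' = n * θ + δ := by rw [hδ]; ring
  rw [hb] at h'
  have hsinθ : sin θ = sin ((n + 1) * θ) * cos (n * θ) - cos ((n + 1) * θ) * sin (n * θ) := by
    rw [← Real.sin_sub]
    ring_nf
  have hkey : √2 * (sin ((n + 1) * θ + δ) - sin ((n + 1) * θ')) * R
      = sin δ + 2 * √2 * ε * sin θ * cos δ := by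
    have h1 : √2 * (sin ((n + 1) * θ + δ) - sin ((n + 1) * θ'))
        = √2 * sin ((n + 1) * θ + δ) - ε * sin (n * θ + δ) := by linear_combination -h'
    rw [h1, hsinθ, hR, Real.sin_add, Real.sin_add]
    linear_combination (cos δ * (√2 * cos ((n + 1) * θ) - ε * cos (n * θ))
        - sin δ * (√2 * sin ((n + 1) * θ) - ε * sin (n * θ))) * h
      + sin δ * ((sin ((n + 1) * θ) ^ 2 + cos ((n + 1) * θ) ^ 2) * h2
        - (sin (n * θ) ^ 2 + cos (n * θ) ^ 2) * hε2
        + 2 * Real.sin_sq_add_cos_sq ((n + 1) * θ) - Real.sin_sq_add_cos_sq (n * θ))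
  have hupper : |√2 * (sin ((n + 1) * θ + δ) - sin ((n + 1) * θ')) * R| ≤
      1.42 * (4 / 3 / 100) * 2.42 := by
    rw [abs_mul, abs_mul, abs_of_nonneg (Real.sqrt_nonneg 2)]
    gcongr
    · exact sqrt_two_lt.le
    · refine hclose.trans ?_
      rw [le_div_iff₀ (by norm_num)]
      nlinarith [abs_nonneg (θ' - θ), Real.pi_lt_four]
    · exact abs_sqrt_two_mul_cos_add_le hε
  rw [hkey, abs_le] at hupper
  have h3 : (1.73 : ℝ) < √3 := Real.lt_sqrt_of_sq_lt (by norm_num)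
  have hbig : 2 * 1.41 * (1.73 / 2) * (1 / 2) ≤ 2 * √2 * sin θ * cos δ := by
    have := sqrt_two_gt
    have hsin : 1.73 / 2 ≤ sin θ := by linarith
    have : 0 ≤ sin θ := by linarith
    gcongr
  have hs := Real.sin_sq_add_cos_sq δ
  have hs1 : |sin δ| ≤ 0.88 := abs_le_of_sq_le_sq (by nlinarith) (by norm_num)
  rw [abs_le] at hs1
  rcases hε with rfl | rfl <;> linarith [hupper.1, hupper.2, hs1.1, hs1.2]

lemma sqrt_three_div_two_le_sin {θ : ℝ} (hθ : θ ∈ Set.Ioo (π / 3) (2 * π / 3)) :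
    √3 / 2 ≤ sin θ := by
  have h : |θ - π / 2| ≤ π / 6 := by rw [abs_le]; constructor <;> linarith [hθ.1, hθ.2]
  rw [← Real.cos_sub_pi_div_two, ← Real.cos_abs, ← Real.cos_pi_div_six]
  exact Real.cos_le_cos_of_nonneg_of_le_pi (abs_nonneg _) (by linarith [Real.pi_pos]) h

/-- Minimal gap between roots: for large `n`, any root `θ ∈ (π/3, 2π/3)` is at distance
at least `(π − 2θ₀)/n` from any other root `θ' ∈ (0, π)`, where
`θ₀ = arctan(√3/(√2−1))`. -/
theorem stmt2 :
    ∃ N : ℤ, ∀ n : ℕ, N ≤ (n : ℤ) →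
      ∀ ε ε' : ℝ, (ε = 1 ∨ ε = -1) → (ε' = 1 ∨ ε' = -1) →
        ∀ θ θ' : ℝ, θ ∈ Set.Ioo (π/3) (2*π/3) → IsRoot n ε θ →
          θ' ∈ Set.Ioo 0 π → IsRoot n ε' θ' → θ' ≠ θ →
            |θ - θ'| ≥ (π - 2 * Real.arctan (Real.sqrt 3 / (Real.sqrt 2 - 1))) / n := by
  refine ⟨100, fun n hn ε ε' hε hε' θ θ' hθ h _ h' hne ↦ ?_⟩
  have hn : 100 ≤ n := by exact_mod_cast hn
  have hpos : (0 : ℝ) < n := by positivity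
  have h := h.sqrt_two_mul_sin_add
  have h' := h'.sqrt_two_mul_sin_add
  suffices hgap : π / 3 ≤ n * |θ' - θ| by
    rw [ge_iff_le, div_le_iff₀ hpos, abs_sub_comm, mul_comm _ (n : ℝ)]
    exact pi_sub_two_mul_arctan_lt.le.trans hgap
  have hsign : ε' = ε ∨ ε' = -ε := by
    rcases hε with rfl | rfl <;> rcases hε' with rfl | rfl <;> norm_num
  rcases hsign with rfl | rfl
  · rcases hne.lt_or_gt with hlt | hlt
    · rw [abs_sub_comm, abs_of_pos (sub_pos.mpr hlt)]
      exact pi_div_three_le_of_same_sign hn hε h' h hlt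
    · rw [abs_of_pos (sub_pos.mpr hlt)]
      exact pi_div_three_le_of_same_sign hn hε h h' hlt
  · exact pi_div_three_le_of_opposite_sign hn hε (sqrt_three_div_two_le_sin hθ) h
      (by linear_combination h')
end

section
/- Let n be a positive integer and l an integer. (i) If δ ∈ (0, π/n) and θ := lπ/n − δ lies in (π/3, 2π/3) and is a (+1)-root (i.e. √2·sin((n+1)θ) + sin(nθ) = 0), then tan(nδ) = √2·sinθ/(1 + √2·cosθ), and consequently arctan(√3/(√2+1))/n < δ < arctan(√3/(√2−1))/n. (ii) If δ' ∈ (0, π/n) and θ' := lπ/n + δ' lies in (π/3, 2π/3) and is a (−1)-root (i.e. √2·sin((n+1)θ') − sin(nθ') = 0), then tan(nδ') = √2·sinθ'/(1 − √2·cosθ'), and the same bounds arctan(√3/(√2+1))/n < δ' < arctan(√3/(√2−1))/n hold. -/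
open Real

/-- If `φ ∈ (π/3, 2π/3)` and `x ∈ (0, π)` satisfy `√2·sin(φ − x) = sin x`, then `tan x` is
determined by `φ`, and `x` lies between the values attained at the endpoints for `φ`. -/
theorem tan_eq_and_bounds_of_sqrt_two_mul_sin_sub {φ x : ℝ} (hφ : φ ∈ Set.Ioo (π / 3) (2 * π / 3))
    (hx : x ∈ Set.Ioo 0 π) (h : √2 * sin (φ - x) = sin x) :
    tan x = √2 * sin φ / (1 + √2 * cos φ) ∧
      arctan (√3 / (√2 + 1)) < x ∧ x < arctan (√3 / (√2 - 1)) := by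
  obtain ⟨hφ₁, hφ₂⟩ := hφ
  obtain ⟨hx₁, hx₂⟩ := hx
  have hπ := pi_pos
  have hcos_lt : cos φ < 1 / 2 := by
    rw [← cos_pi_div_three]
    exact cos_lt_cos_of_nonneg_of_le_pi (by linarith) (by linarith) hφ₁
  have hcos_gt : -(1 / 2) < cos φ := by
    have := cos_lt_cos_of_nonneg_of_le_pi (x := φ) (y := π - π / 3) (by linarith) (by linarith)
      (by linarith)
    rwa [cos_pi_sub, cos_pi_div_three] at this
  have hsin : 0 < sin φ := sin_pos_of_pos_of_lt_pi (by linarith) (by linarith)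
  have hsinx : 0 < sin x := sin_pos_of_pos_of_lt_pi hx₁ hx₂
  have h2 : √2 ^ 2 = 2 := sq_sqrt (by norm_num)
  have h3 : √3 ^ 2 = 3 := sq_sqrt (by norm_num)
  have h2_gt : 1 < √2 := by rw [lt_sqrt] <;> norm_num
  have h2_lt : √2 < 2 := by rw [sqrt_lt'] <;> norm_num
  have h3_pos : 0 < √3 := by positivity
  have hsq := sin_sq_add_cos_sq φ
  have hden : 0 < 1 + √2 * cos φ := by nlinarith
  have hmul : √2 * sin φ * cos x = (1 + √2 * cos φ) * sin x := by
    rw [sin_sub] at h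
    linarith
  have hcosx : 0 < cos x := by
    have : 0 < √2 * sin φ * cos x := hmul ▸ mul_pos hden hsinx
    exact pos_of_mul_pos_right this (by positivity)
  have htan : tan x = √2 * sin φ / (1 + √2 * cos φ) := by
    rw [tan_eq_sin_div_cos, div_eq_div_iff hcosx.ne' hden.ne']
    linarith
  have hx_lt : x < π / 2 := by
    by_contra! hle
    exact absurd (cos_nonpos_of_pi_div_two_le_of_le hle (by linarith)) (not_le.mpr hcosx)
  have harctan : arctan (tan x) = x := arctan_tan (by linarith) hx_lt
  have hsin_gt : √3 / 2 < sin φ := by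
    refine lt_of_pow_lt_pow_left₀ 2 hsin.le ?_
    nlinarith
  have hsin_le : √3 * sin φ ≤ 2 + cos φ := by
    nlinarith [sq_nonneg (sin φ - √3 / 2), sq_nonneg (cos φ + 1 / 2)]
  refine ⟨htan, ?_, ?_⟩
  · rw [← harctan, arctan_lt_arctan_iff, htan, div_lt_div_iff₀ (by positivity) hden]
    have h₁ : √3 * (√2 * cos φ) < √3 * (√2 * (1 / 2)) := by gcongr
    have h₂ : √2 * (√2 + 1) * (√3 / 2) < √2 * (√2 + 1) * sin φ := by gcongr
    linear_combination h₁ + h₂ - √3 / 2 * h2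
  · rw [← harctan, arctan_lt_arctan_iff, htan, div_lt_div_iff₀ hden (by linarith)]
    refine lt_of_mul_lt_mul_left ?_ h3_pos.le
    have h₁ : (2 - √2) * (√3 * sin φ) ≤ (2 - √2) * (2 + cos φ) := by
      gcongr
    have h₂ : 0 < (4 * √2 - 2) * (cos φ + 1 / 2) := mul_pos (by linarith) (by linarith)
    linear_combination h₁ + h₂ + √3 * sin φ * h2 - (1 + √2 * cos φ) * h3

/-- A factor `(-1) ^ l` can be cancelled from an equation. -/
theorem eq_zero_of_neg_one_zpow_mul {l : ℤ} {a : ℝ} (h : (-1) ^ l * a = 0) : a = 0 :=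
  (mul_eq_zero.mp h).resolve_left (zpow_ne_zero l (by norm_num))

/-- Location of the roots of `√2·sin((n+1)θ) ± sin(nθ) = 0` near the points `lπ/n`:
(i) if `θ = lπ/n − δ ∈ (π/3, 2π/3)` with `δ ∈ (0, π/n)` satisfies
`√2·sin((n+1)θ) + sin(nθ) = 0`, then `tan(nδ) = √2·sinθ/(1 + √2·cosθ)` and
`arctan(√3/(√2+1))/n < δ < arctan(√3/(√2−1))/n`;
(ii) if `θ' = lπ/n + δ' ∈ (π/3, 2π/3)` with `δ' ∈ (0, π/n)` satisfies
`√2·sin((n+1)θ') − sin(nθ') = 0`, then `tan(nδ') = √2·sinθ'/(1 − √2·cosθ')` and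
the same bounds hold for `δ'`. -/
theorem stmt3 (n : ℕ) (hn : 0 < n) (l : ℤ) :
    (∀ δ : ℝ, δ ∈ Set.Ioo 0 (π/n) →
      (l * π / n - δ) ∈ Set.Ioo (π/3) (2*π/3) →
      Real.sqrt 2 * Real.sin ((n+1) * (l * π / n - δ)) + Real.sin (n * (l * π / n - δ)) = 0 →
      Real.tan (n * δ) =
          Real.sqrt 2 * Real.sin (l * π / n - δ) / (1 + Real.sqrt 2 * Real.cos (l * π / n - δ)) ∧
        Real.arctan (Real.sqrt 3 / (Real.sqrt 2 + 1)) / n < δ ∧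
        δ < Real.arctan (Real.sqrt 3 / (Real.sqrt 2 - 1)) / n) ∧
    (∀ δ' : ℝ, δ' ∈ Set.Ioo 0 (π/n) →
      (l * π / n + δ') ∈ Set.Ioo (π/3) (2*π/3) →
      Real.sqrt 2 * Real.sin ((n+1) * (l * π / n + δ')) - Real.sin (n * (l * π / n + δ')) = 0 →
      Real.tan (n * δ') =
          Real.sqrt 2 * Real.sin (l * π / n + δ') / (1 - Real.sqrt 2 * Real.cos (l * π / n + δ')) ∧
        Real.arctan (Real.sqrt 3 / (Real.sqrt 2 + 1)) / n < δ' ∧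
        δ' < Real.arctan (Real.sqrt 3 / (Real.sqrt 2 - 1)) / n) := by
  have hn' : (0 : ℝ) < n := by exact_mod_cast hn
  have hmem {d : ℝ} (hd : d ∈ Set.Ioo 0 (π / n)) : n * d ∈ Set.Ioo 0 π :=
    ⟨mul_pos hn' hd.1, by rw [mul_comm]; exact (lt_div_iff₀ hn').mp hd.2⟩
  have hbounds {a b d : ℝ} (h : a < n * d ∧ n * d < b) : a / n < d ∧ d < b / n := by
    rw [div_lt_iff₀' hn', lt_div_iff₀' hn']
    exact h
  refine ⟨fun δ hδ hθ hroot => ?_, fun δ hδ hθ hroot => ?_⟩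
  · set θ := l * π / n - δ with hθ_def
    have hnθ : n * θ = l * π - n * δ := by rw [hθ_def]; field_simp
    rw [show (n + 1) * θ = l * π - (n * δ - θ) by linarith, hnθ, sin_int_mul_pi_sub,
      sin_int_mul_pi_sub] at hroot
    have hsin : √2 * sin (θ - n * δ) = sin (n * δ) := by
      rw [← neg_sub, sin_neg]
      have := eq_zero_of_neg_one_zpow_mul (l := l)
        (a := √2 * sin (n * δ - θ) + sin (n * δ)) (by linear_combination -hroot)
      linarith
    obtain ⟨htan, hb⟩ := tan_eq_and_bounds_of_sqrt_two_mul_sin_sub hθ (hmem hδ) hsin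
    exact ⟨htan, hbounds hb⟩
  · set θ := l * π / n + δ with hθ_def
    have hnθ : n * θ = n * δ + l * π := by rw [hθ_def]; field_simp; ring
    rw [show (n + 1) * θ = (n * δ + θ) + l * π by linarith, hnθ, sin_add_int_mul_pi,
      sin_add_int_mul_pi] at hroot
    have hsin : √2 * sin ((π - θ) - n * δ) = sin (n * δ) := by
      rw [sub_sub, sin_pi_sub, add_comm]
      have := eq_zero_of_neg_one_zpow_mul (l := l)
        (a := √2 * sin (n * δ + θ) - sin (n * δ)) (by linear_combination hroot)
      linarith
    obtain ⟨htan, hb⟩ := tan_eq_and_bounds_of_sqrt_two_mul_sin_sub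
      (φ := π - θ) ⟨by linarith [hθ.2], by linarith [hθ.1]⟩ (hmem hδ) hsin
    rw [sin_pi_sub, cos_pi_sub, mul_neg, ← sub_eq_add_neg] at htan
    exact ⟨htan, hbounds hb⟩
end

section
/- Let v ∈ ℂ^r with ‖v‖ = 1 and let ε ∈ {+1, −1}. If Aᴴ·R·A·v = ε·v, then U·(A·v) = ε·(A·v). -/
open Matrix

open scoped ComplexOrder in
/-- A Hermitian involution `R` compressed by an isometry `A` has `v` as an `ε`-eigenvector,
`ε = ±1`, only if `A·v` is an `ε`-eigenvector of `R` itself. -/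
theorem mulVec_eq_smul_of_compression {m n : Type*} [Fintype m] [Fintype n] [DecidableEq m]
    [DecidableEq n] {A : Matrix m n ℂ} (hA : Aᴴ * A = 1) {R : Matrix m m ℂ} (hR : Rᴴ = R)
    (hR2 : R * R = 1) {v : n → ℂ} {ε : ℂ} (hε : ε = 1 ∨ ε = -1)
    (heig : (Aᴴ * R * A) *ᵥ v = ε • v) : R *ᵥ (A *ᵥ v) = ε • A *ᵥ v := by
  have hstar : star ε = ε := by rcases hε with rfl | rfl <;> simp
  have hsq : ε * ε = 1 := by rcases hε with rfl | rfl <;> simp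
  have hgram : (R * A - ε • A)ᴴ * (R * A - ε • A) = (2 : ℂ) • (1 - ε • (Aᴴ * R * A)) := by
    have hRR : Aᴴ * R * (R * A) = 1 := by
      rw [Matrix.mul_assoc, ← Matrix.mul_assoc R, hR2, Matrix.one_mul, hA]
    simp only [conjTranspose_sub, conjTranspose_mul, conjTranspose_smul, hR, hstar,
      Matrix.sub_mul, Matrix.mul_sub, Matrix.smul_mul, Matrix.mul_smul, hRR, hA,
      ← Matrix.mul_assoc Aᴴ R A]
    linear_combination (norm := module) hsq • (1 : Matrix n n ℂ)
  have hker : (R * A - ε • A) *ᵥ v = 0 := by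
    rw [← conjTranspose_mul_self_mulVec_eq_zero, hgram, smul_mulVec, sub_mulVec, smul_mulVec,
      heig, smul_smul, hsq]
    simp
  rwa [sub_mulVec, smul_mulVec, ← mulVec_mulVec, sub_eq_zero] at hker

/-- If `Aᴴ·R·A·v = ε·v` with `‖v‖ = 1` and `ε = ±1`, then `A·v` is an eigenvector of
`U = R·(2AAᴴ − I)` with eigenvalue `ε`. -/
theorem stmt5 (m r : ℕ) (hm : 0 < m) (hr : 0 < r)
    (A : Matrix (Fin m) (Fin r) ℂ) (hA : Aᴴ * A = 1)
    (R : Matrix (Fin m) (Fin m) ℂ) (hR : Rᴴ = R) (hR2 : R * R = 1)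
    (v : EuclideanSpace ℂ (Fin r)) (hv : ‖v‖ = 1)
    (ε : ℂ) (hε : ε = 1 ∨ ε = -1)
    (heig : (Aᴴ * R * A).mulVec v = ε • (v : Fin r → ℂ)) :
    (R * (2 • (A * Aᴴ) - 1)).mulVec (A.mulVec v) = ε • A.mulVec v := by
  have hfix : (2 • (A * Aᴴ) - 1) *ᵥ (A *ᵥ (v : Fin r → ℂ)) = A *ᵥ v := by
    rw [mulVec_mulVec, Matrix.sub_mul, Matrix.smul_mul, Matrix.mul_assoc, hA, Matrix.mul_one,
      Matrix.one_mul, two_smul, add_sub_cancel_right]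
  rw [← mulVec_mulVec, hfix]
  exact mulVec_eq_smul_of_compression hA hR hR2 hε heig
end

section
/- For every real number λ: det(λ·I − J) = (λ² − 1) · p^n · q^{n−1} · ( q·U_n(λ/√(pq))² − p·U_{n−1}(λ/√(pq))² ). -/
open Matrix

/-- Superdiagonal entries of the reduced matrix `J` (0-indexed positions `0, …, 2n`):
`√p` at position `0` and `2n`, `q` at position `n`, and `√(pq)` elsewhere,
with `p = 1/3`, `q = 2/3`. -/
noncomputable def Jsuper (n i : ℕ) : ℝ :=
  if i = 0 ∨ i = 2*n then Real.sqrt (1/3)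
  else if i = n then 2/3
  else Real.sqrt ((1/3) * (2/3))

/-- The `(2n+2)×(2n+2)` symmetric tridiagonal matrix `J` with zero diagonal and
superdiagonal entries `√p, √(pq), …, √(pq), q, √(pq), …, √(pq), √p`. -/
noncomputable def Jmat (n : ℕ) : Matrix (Fin (2*n+2)) (Fin (2*n+2)) ℝ :=
  Matrix.of fun i j =>
    if i.val + 1 = j.val then Jsuper n i.val
    else if j.val + 1 = i.val then Jsuper n j.val
    else 0

/-- The monic Chebyshev polynomials of the second kind:
`U_0(x) = 1`, `U_1(x) = x`, `U_k(x) = x·U_{k−1}(x) − U_{k−2}(x)`,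
so that `U_k(2cosθ)·sinθ = sin((k+1)θ)`. -/
noncomputable def Um : ℕ → ℝ → ℝ
  | 0, _ => 1
  | 1, x => x
  | (k+2), x => x * Um (k+1) x - Um k x

/-- The symmetric tridiagonal matrix of size `m` with constant diagonal `a` and off-diagonal
entries `-b 0, -b 1, …`. -/
def symmTridiag {R : Type*} [CommRing R] (a : R) (b : ℕ → R) (m : ℕ) : Matrix (Fin m) (Fin m) R :=
  Matrix.of fun i j =>
    if i = j then a
    else if i.val + 1 = j.val then -b i.val
    else if j.val + 1 = i.val then -b j.val
    else 0

theorem det_symmTridiag_add_two {R : Type*} [CommRing R] (a : R) (b : ℕ → R) (m : ℕ) :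
    (symmTridiag a b (m + 2)).det =
      a * (symmTridiag a b (m + 1)).det - b m ^ 2 * (symmTridiag a b m).det := by
  have hminor : ((symmTridiag a b (m + 2)).submatrix Fin.castSucc
      (Fin.last m).castSucc.succAbove).det = -b m * (symmTridiag a b m).det := by
    rw [det_succ_column _ (Fin.last m), Fin.sum_univ_castSucc, Finset.sum_eq_zero]
    · have h : (((symmTridiag a b (m + 2)).submatrix Fin.castSucc
          (Fin.last m).castSucc.succAbove).submatrix (Fin.last m).succAbove
          (Fin.last m).succAbove) = symmTridiag a b m := by
        ext i j
        have hj : (Fin.last m).castSucc.succAbove j.castSucc = j.castSucc.castSucc :=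
          Fin.succAbove_of_castSucc_lt _ _ (by simp [Fin.lt_def])
        simp [symmTridiag, hj, Fin.ext_iff]
      rw [h]
      simp [symmTridiag, Fin.ext_iff, ← two_mul]
    · intro i _
      have h1 : i.val ≠ m + 1 := by have := i.isLt; omega
      have h2 : i.val ≠ m := by have := i.isLt; omega
      have h3 : m + 1 + 1 ≠ i.val := by have := i.isLt; omega
      simp [symmTridiag, Fin.ext_iff, h1, h2, h3]
  rw [det_succ_row _ (Fin.last (m + 1)), Fin.sum_univ_castSucc, Fin.sum_univ_castSucc,
    Finset.sum_eq_zero]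
  · have h : ((symmTridiag a b (m + 2)).submatrix (Fin.last (m + 1)).succAbove
        (Fin.last (m + 1)).succAbove) = symmTridiag a b (m + 1) := by
      ext i j
      simp [symmTridiag, Fin.ext_iff]
    rw [h, Fin.succAbove_last, hminor]
    have hs : (-1 : R) ^ (m + 1 + m) = -1 := Odd.neg_one_pow ⟨m, by ring⟩
    have hne : m + 1 + 1 ≠ m := by omega
    simp [symmTridiag, Fin.ext_iff, hs, hne, ← two_mul]
    ring
  · intro i _
    have h1 : m + 1 ≠ i.val := by have := i.isLt; omega
    have h2 : i.val ≠ m := by have := i.isLt; omega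
    have h3 : m + 1 + 1 ≠ i.val := by have := i.isLt; omega
    simp [symmTridiag, Fin.ext_iff, h1, h2, h3]

/-- The solution of `f (k + 2) = a * f (k + 1) - c * f k` with `f 0 = 0` and `f 1 = 1`. -/
def lucasSeq {R : Type*} [CommRing R] (a c : R) : ℕ → R
  | 0 => 0
  | 1 => 1
  | k + 2 => a * lucasSeq a c (k + 1) - c * lucasSeq a c k

theorem lucasSeq_succ_eq_pow_mul_Um {s : ℝ} (hs : s ≠ 0) (a : ℝ) :
    ∀ k, lucasSeq a (s ^ 2) (k + 1) = s ^ k * Um k (a / s)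
  | 0 => by simp [lucasSeq, Um]
  | 1 => by simp [lucasSeq, Um]; field_simp
  | k + 2 => by
    rw [lucasSeq, lucasSeq_succ_eq_pow_mul_Um hs a (k + 1), lucasSeq_succ_eq_pow_mul_Um hs a k, Um]
    field_simp
    ring

theorem det_symmTridiag_left {R : Type*} [CommRing R] {a c p : R} {b : ℕ → R} {n : ℕ}
    (h0 : b 0 ^ 2 = p) (hc : ∀ i, 0 < i → i < n → b i ^ 2 = c) :
    ∀ k ≤ n, (symmTridiag a b (k + 1)).det = a * lucasSeq a c (k + 1) - p * lucasSeq a c k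
  | 0, _ => by simp [symmTridiag, lucasSeq]
  | 1, _ => by
    rw [det_symmTridiag_add_two, h0]
    simp [symmTridiag, lucasSeq]
  | k + 2, hk => by
    rw [det_symmTridiag_add_two, hc (k + 1) (by omega) (by omega),
      det_symmTridiag_left h0 hc (k + 1) (by omega), det_symmTridiag_left h0 hc k (by omega)]
    simp only [lucasSeq]
    ring

theorem det_symmTridiag_right {R : Type*} [CommRing R] {a c d : R} {b : ℕ → R} {n m : ℕ}
    (hd : b n ^ 2 = d) (hc : ∀ i, n < i → i < m → b i ^ 2 = c) :
    ∀ j, n + j ≤ m → (symmTridiag a b (n + 1 + j)).det =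
      (symmTridiag a b (n + 1)).det * lucasSeq a c (j + 1)
        - d * (symmTridiag a b n).det * lucasSeq a c j
  | 0, _ => by simp [lucasSeq]
  | 1, _ => by
    rw [show n + 1 + 1 = n + 2 from rfl, det_symmTridiag_add_two, hd]
    simp [lucasSeq]
    ring
  | j + 2, hj => by
    rw [← add_assoc, det_symmTridiag_add_two, hc (n + 1 + j) (by omega) (by omega),
      add_assoc (n + 1) j 1, det_symmTridiag_right hd hc (j + 1) (by omega),
      det_symmTridiag_right hd hc j (by omega)]
    simp only [lucasSeq]
    ring

theorem smul_one_sub_Jmat (n : ℕ) (a : ℝ) :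
    a • (1 : Matrix (Fin (2*n+2)) (Fin (2*n+2)) ℝ) - Jmat n =
      symmTridiag a (Jsuper n) (2*n+2) := by
  ext i j
  by_cases h : i = j
  · subst h
    simp [symmTridiag, Jmat]
  · simp only [symmTridiag, Jmat, Matrix.sub_apply, Matrix.smul_apply, one_apply_ne h, of_apply, if_neg h]
    split_ifs <;> simp

theorem det_symmTridiag_Jsuper (n : ℕ) (a : ℝ) :
    (symmTridiag a (Jsuper (n + 1)) (2 * (n + 1) + 2)).det =
      (a ^ 2 - 1) * (lucasSeq a (2/9) (n + 2) ^ 2 - 1/9 * lucasSeq a (2/9) (n + 1) ^ 2) := by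
  have hs : Real.sqrt (1/3 * (2/3)) ^ 2 = 2/9 := by rw [Real.sq_sqrt] <;> norm_num
  have hp : Real.sqrt (1/3) ^ 2 = 1/3 := by rw [Real.sq_sqrt]; norm_num
  have h0 : Jsuper (n + 1) 0 ^ 2 = 1/3 := by rw [Jsuper, if_pos (Or.inl rfl), hp]
  have hend : Jsuper (n + 1) (2 * (n + 1)) ^ 2 = 1/3 := by rw [Jsuper, if_pos (Or.inr rfl), hp]
  have hmid : Jsuper (n + 1) (n + 1) ^ 2 = 4/9 := by
    rw [Jsuper, if_neg (by omega), if_pos rfl]; norm_num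
  have hgen : ∀ i, i ≠ 0 → i ≠ n + 1 → i ≠ 2 * (n + 1) → Jsuper (n + 1) i ^ 2 = 2/9 :=
    fun i h1 h2 h3 => by rw [Jsuper, if_neg (by tauto), if_neg h2, hs]
  have left := det_symmTridiag_left (a := a) (n := n + 1) h0
    fun i h1 h2 => hgen i (by omega) (by omega) (by omega)
  have right := det_symmTridiag_right (a := a) (m := 2 * (n + 1)) hmid
    fun i h1 h2 => hgen i (by omega) (by omega) (by omega)
  rw [det_symmTridiag_add_two, hend, show 2 * (n + 1) + 1 = n + 1 + 1 + (n + 1) by ring,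
    right (n + 1) (by omega), show 2 * (n + 1) = n + 1 + 1 + n by ring, right n (by omega),
    left (n + 1) le_rfl, left n (by omega)]
  simp only [lucasSeq]
  ring

/-- Characteristic polynomial of `J`:
`det(λI − J) = (λ² − 1)·p^n·q^{n−1}·(q·U_n(λ/√(pq))² − p·U_{n−1}(λ/√(pq))²)`. -/
theorem stmt7 (n : ℕ) (hn : 0 < n) (lam : ℝ) :
    (lam • (1 : Matrix (Fin (2*n+2)) (Fin (2*n+2)) ℝ) - Jmat n).det =
      (lam ^ 2 - 1) * (1/3 : ℝ) ^ n * (2/3 : ℝ) ^ (n - 1) *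
        ((2/3) * (Um n (lam / Real.sqrt ((1/3) * (2/3)))) ^ 2
          - (1/3) * (Um (n - 1) (lam / Real.sqrt ((1/3) * (2/3)))) ^ 2) := by
  obtain ⟨n, rfl⟩ : ∃ k, n = k + 1 := ⟨n - 1, by omega⟩
  have hs : Real.sqrt (1/3 * (2/3)) ^ 2 = 2/9 := by rw [Real.sq_sqrt] <;> norm_num
  have hs0 : Real.sqrt (1/3 * (2/3)) ≠ 0 := by positivity
  have key := lucasSeq_succ_eq_pow_mul_Um hs0 lam
  rw [hs] at key
  rw [smul_one_sub_Jmat, det_symmTridiag_Jsuper, key (n + 1), key n, mul_pow, mul_pow,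
    ← pow_mul, ← pow_mul, mul_comm (n + 1) 2, mul_comm n 2, pow_mul, pow_mul, hs,
    show (2/9 : ℝ) = 1/3 * (2/3) by norm_num, mul_pow, mul_pow, Nat.add_sub_cancel]
  ring
end

section
/- For every ε ∈ {+1, −1} and every integer k with 1 ≤ k ≤ n+1, letting J_k denote the top-left k×k principal submatrix of J, one has det(ε·I_k − J_k) = ε^k · q^{k−1}. -/
open Matrix

/-- The three-term recurrence for the leading principal minors of a tridiagonal matrix. -/
theorem det_tridiagonal_succ_succ {R : Type*} [CommRing R] (f : ℕ → ℕ → R)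
    (hf : ∀ i j, i + 1 < j ∨ j + 1 < i → f i j = 0) (k : ℕ) :
    (Matrix.of fun i j : Fin (k + 2) => f i j).det =
      f (k + 1) (k + 1) * (Matrix.of fun i j : Fin (k + 1) => f i j).det -
        f k (k + 1) * f (k + 1) k * (Matrix.of fun i j : Fin k => f i j).det := by
  have minor_last : ((Matrix.of fun i j : Fin (k + 2) => f i j).submatrix
      (Fin.last (k + 1)).succAbove (Fin.last (k + 1)).succAbove) =
      Matrix.of fun i j : Fin (k + 1) => f i j := by
    ext i j; simp
  have minor_prev : ((Matrix.of fun i j : Fin (k + 2) => f i j).submatrix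
      (Fin.last (k + 1)).succAbove (Fin.last k).castSucc.succAbove).det =
      f k (k + 1) * (Matrix.of fun i j : Fin k => f i j).det := by
    rw [det_succ_column _ (Fin.last k), Fin.sum_univ_castSucc, Finset.sum_eq_zero]
    · have : (((Matrix.of fun i j : Fin (k + 2) => f i j).submatrix
          (Fin.last (k + 1)).succAbove (Fin.last k).castSucc.succAbove).submatrix
          (Fin.last k).succAbove (Fin.last k).succAbove) =
          Matrix.of fun i j : Fin k => f i j := by
        ext i j
        have hj : (Fin.last k).castSucc.succAbove j.castSucc = j.castSucc.castSucc :=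
          Fin.succAbove_of_castSucc_lt _ _ (by simp [Fin.lt_def])
        simp [hj]
      rw [this]
      simp [← two_mul]
    · intro i _
      have : f i (k + 1) = 0 := hf _ _ (Or.inl (by omega))
      simp [this]
  rw [det_succ_row _ (Fin.last (k + 1)), Fin.sum_univ_castSucc, Fin.sum_univ_castSucc,
    Finset.sum_eq_zero, minor_last, minor_prev]
  · have h : (-1 : R) ^ (k + 1 + k) = -1 := Odd.neg_one_pow ⟨k, by ring⟩
    simp [h, ← two_mul]
    ring
  · intro i _
    have : f (k + 1) i = 0 := hf _ _ (Or.inr (by omega))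
    simp [this]

/-- The entries of `ε • 1 - J`, indexed by natural numbers. -/
noncomputable def shiftedJ (n : ℕ) (ε : ℝ) (i j : ℕ) : ℝ :=
  (if i = j then ε else 0) -
    if i + 1 = j then Jsuper n i else if j + 1 = i then Jsuper n j else 0

theorem det_shiftedJ_succ (n : ℕ) (ε : ℝ) (hε : ε ^ 2 = 1) (k : ℕ) (hk : k ≤ n) :
    (Matrix.of fun i j : Fin (k + 1) => shiftedJ n ε i j).det = ε ^ (k + 1) * (2 / 3) ^ k := by
  have h_zero : ∀ i j, i + 1 < j ∨ j + 1 < i → shiftedJ n ε i j = 0 := by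
    intro i j h
    unfold shiftedJ
    rw [if_neg (by omega), if_neg (by omega), if_neg (by omega), sub_zero]
  have h_diag : ∀ i, shiftedJ n ε i i = ε := by intro i; simp [shiftedJ]
  have h_super : ∀ i, shiftedJ n ε i (i + 1) = -Jsuper n i := by intro i; simp [shiftedJ]
  have h_sub : ∀ i, shiftedJ n ε (i + 1) i = -Jsuper n i := by
    intro i; simp [shiftedJ, show i + 1 + 1 ≠ i by omega]
  induction k using Nat.twoStepInduction with
  | zero => simp [h_diag]
  | one =>
    have h0 : Jsuper n 0 * Jsuper n 0 = 1 / 3 := by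
      rw [Jsuper, if_pos (Or.inl rfl), Real.mul_self_sqrt (by norm_num)]
    rw [det_tridiagonal_succ_succ _ h_zero, h_diag, h_super, h_sub, neg_mul_neg, h0]
    simp [h_diag]
    linear_combination (1 / 3 : ℝ) * hε
  | more k ih₀ ih₁ =>
    have h1 : Jsuper n (k + 1) * Jsuper n (k + 1) = 1 / 3 * (2 / 3) := by
      rw [Jsuper, if_neg (by omega), if_neg (by omega), Real.mul_self_sqrt (by norm_num)]
    rw [det_tridiagonal_succ_succ _ h_zero, h_diag, h_super, h_sub, neg_mul_neg, h1,
      ih₀ (by omega), ih₁ (by omega)]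
    linear_combination (2 / 9 : ℝ) * ε ^ (k + 1) * (2 / 3) ^ k * hε

/-- Determinant of the top-left `k×k` principal submatrix of `εI − J`:
for `ε = ±1` and `1 ≤ k ≤ n+1`, `det(ε·I_k − J_k) = ε^k·q^{k−1}`. -/
theorem stmt10 (n : ℕ) (hn : 0 < n) (ε : ℝ) (hε : ε = 1 ∨ ε = -1)
    (k : ℕ) (hk1 : 1 ≤ k) (hk2 : k ≤ n + 1) :
    (ε • (1 : Matrix (Fin k) (Fin k) ℝ) -
        (Jmat n).submatrix (Fin.castLE (by omega : k ≤ 2*n+2))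
          (Fin.castLE (by omega : k ≤ 2*n+2))).det = ε ^ k * (2/3 : ℝ) ^ (k - 1) := by
  obtain ⟨k, rfl⟩ := Nat.exists_eq_add_of_le' hk1
  rw [Nat.add_sub_cancel,
    ← det_shiftedJ_succ n ε (by rcases hε with rfl | rfl <;> norm_num) k (by omega)]
  congr 1
  ext i j
  simp [shiftedJ, Jmat, Matrix.one_apply, Fin.ext_iff]
end

section
/- For every even natural number t, the (4n+1, 0) entry of the matrix power M_U^t is equal to zero. -/
open Matrix

/-- `M_U` couples only basis states sitting at vertices `⌊(i + 1) / 2⌋` of opposite parity. -/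
theorem MU_apply_eq_zero (n : ℕ) (i j : Fin (4*n+2))
    (h : (i.val + 1) / 2 % 2 = (j.val + 1) / 2 % 2) : MU n i j = 0 := by
  rw [MU, Matrix.mul_apply]
  refine Finset.sum_eq_zero fun k _ => ?_
  by_cases hS : i.val / 2 = k.val / 2 ∧ i ≠ k
  · have hik : i.val ≠ k.val := fun e => hS.2 (Fin.ext e)
    have hkj : k ≠ j := by
      rintro rfl
      omega
    have hC : ¬((k.val % 2 = 1 ∧ j.val = k.val + 1) ∨ (j.val % 2 = 1 ∧ k.val = j.val + 1)) := by
      omega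
    simp only [MC, Matrix.of_apply, if_neg hkj, if_neg hC, mul_zero]
  · simp only [MS, Matrix.of_apply, if_neg hS, zero_mul]

/-- The walk is bipartite: after `t` steps the parity of the vertex has changed `t` times. -/
theorem MU_pow_apply_eq_zero (n t : ℕ) (i j : Fin (4*n+2))
    (h : ((i.val + 1) / 2 + (j.val + 1) / 2 + t) % 2 = 1) : (MU n ^ t) i j = 0 := by
  induction t generalizing j with
  | zero =>
    have hij : i ≠ j := by
      rintro rfl
      omega
    rw [pow_zero, Matrix.one_apply_ne hij]
  | succ t ih =>
    rw [pow_succ, Matrix.mul_apply]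
    refine Finset.sum_eq_zero fun k _ => ?_
    by_cases hk : (k.val + 1) / 2 % 2 = (j.val + 1) / 2 % 2
    · rw [MU_apply_eq_zero n k j hk, mul_zero]
    · rw [ih k (by omega), zero_mul]

/-- For every even natural number `t`, the `(4n+1, 0)` entry of `M_U^t` is zero. -/
theorem stmt11 (n : ℕ) (hn : 0 < n) (t : ℕ) (ht : Even t) :
    ((MU n) ^ t) ⟨4*n+1, by omega⟩ ⟨0, by omega⟩ = 0 := by
  obtain ⟨m, rfl⟩ := ht
  apply MU_pow_apply_eq_zero
  dsimp only
  omega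
end

section
/- Define g : (0, π) → ℝ by g(θ) = arccos((2√2/3)·cosθ). Then g is differentiable on (0, π) with derivative g'(θ) = (2√2/3)·sinθ / √(1 − (8/9)·cos²θ); in particular g is strictly increasing on (0, π), and g'(θ) ≥ √(6/7) for every θ ∈ [π/3, 2π/3]. -/
open Real

theorem sq_two_mul_sqrt_two_div_three : (2 * √2 / 3) ^ 2 = (8 / 9 : ℝ) := by
  rw [div_pow, mul_pow, Real.sq_sqrt (by norm_num)]
  norm_num

theorem sq_two_mul_sqrt_two_div_three_mul_lt_one {x : ℝ} (hx : x ^ 2 ≤ 1) :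
    ((2 * √2 / 3) * x) ^ 2 < 1 := by
  rw [mul_pow, sq_two_mul_sqrt_two_div_three]
  linarith

theorem abs_cos_le_half {θ : ℝ} (hθ : θ ∈ Set.Icc (π / 3) (2 * π / 3)) :
    |cos θ| ≤ 1 / 2 := by
  obtain ⟨h₁, h₂⟩ := hθ
  have hπ := pi_pos
  rw [abs_le]
  constructor
  · have h := cos_le_cos_of_nonneg_of_le_pi (x := θ) (y := π - π / 3)
      (by linarith) (by linarith) (by linarith)
    rw [cos_pi_sub, cos_pi_div_three] at h
    exact h
  · have h := cos_le_cos_of_nonneg_of_le_pi (x := π / 3) (y := θ)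
      (by linarith) (by linarith) h₁
    rwa [cos_pi_div_three] at h

/-- The function `g(θ) = arccos((2√2/3)·cosθ)` is differentiable on `(0, π)` with
derivative `g'(θ) = (2√2/3)·sinθ/√(1 − (8/9)·cos²θ)`; in particular it is strictly
increasing on `(0, π)`, and `g'(θ) ≥ √(6/7)` for `θ ∈ [π/3, 2π/3]`. -/
theorem stmt14 :
    (∀ θ ∈ Set.Ioo (0 : ℝ) π,
      HasDerivAt (fun θ' => Real.arccos ((2 * Real.sqrt 2 / 3) * Real.cos θ'))
        ((2 * Real.sqrt 2 / 3) * Real.sin θ / Real.sqrt (1 - (8/9) * Real.cos θ ^ 2)) θ) ∧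
    StrictMonoOn (fun θ' => Real.arccos ((2 * Real.sqrt 2 / 3) * Real.cos θ'))
      (Set.Ioo (0 : ℝ) π) ∧
    ∀ θ ∈ Set.Icc (π/3) (2*π/3),
      (2 * Real.sqrt 2 / 3) * Real.sin θ / Real.sqrt (1 - (8/9) * Real.cos θ ^ 2) ≥
        Real.sqrt (6/7) := by
  refine ⟨fun θ _ => ?_, fun x hx y hy hxy => ?_, fun θ hθ => ?_⟩
  · have hlt := sq_two_mul_sqrt_two_div_three_mul_lt_one (cos_sq_le_one θ)
    have h := (hasDerivAt_arccos (x := (2 * √2 / 3) * cos θ)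
      (by intro h; norm_num [h] at hlt) (by intro h; norm_num [h] at hlt)).comp θ
      ((hasDerivAt_cos θ).const_mul (2 * √2 / 3))
    rw [mul_pow, sq_two_mul_sqrt_two_div_three] at h
    exact h.congr_deriv (by ring)
  · have hx' := abs_le.1 ((sq_lt_one_iff_abs_lt_one _).1
      (sq_two_mul_sqrt_two_div_three_mul_lt_one (cos_sq_le_one x))).le
    have hy' := abs_le.1 ((sq_lt_one_iff_abs_lt_one _).1
      (sq_two_mul_sqrt_two_div_three_mul_lt_one (cos_sq_le_one y))).le
    exact strictAntiOn_arccos hy' hx' (mul_lt_mul_of_pos_left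
      (cos_lt_cos_of_nonneg_of_le_pi hx.1.le hy.2.le hxy) (by positivity))
  · have hc : cos θ ^ 2 ≤ (1 / 2) ^ 2 := sq_le_sq' (abs_le.1 (abs_cos_le_half hθ)).1
      (abs_le.1 (abs_cos_le_half hθ)).2
    have hs : 0 ≤ sin θ := sin_nonneg_of_nonneg_of_le_pi
      (by linarith [hθ.1, pi_pos]) (by linarith [hθ.2, pi_pos])
    have hd : 0 < 1 - (8 / 9) * cos θ ^ 2 := by linarith
    refine Real.sqrt_le_iff.2 ⟨by positivity, ?_⟩
    rw [div_pow, mul_pow, sq_two_mul_sqrt_two_div_three, Real.sq_sqrt hd.le, sin_sq,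
      le_div_iff₀ hd]
    linarith
end

section
/- Let ε ∈ {+1, −1} and let θ ∈ (0, π) be an ε-root. Then ∑_{i=1}^{n} sin²(iθ) = (1/2) · ( n + ε·√2·sin(2(n+1)θ)/(2·sinθ) ). -/
open Real

/-- Closed form for `∑ sin² (iθ)`, with the denominator `sin θ` cleared. -/
theorem two_mul_sin_mul_sum_sin_sq (n : ℕ) (θ : ℝ) :
    2 * sin θ * ∑ i ∈ Finset.Icc 1 n, sin (i * θ) ^ 2 =
      n * sin θ - sin (n * θ) * cos ((n + 1) * θ) := by
  induction n with
  | zero => simp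
  | succ k ih =>
    rw [Finset.sum_Icc_succ_top (by omega), mul_add, ih]
    push_cast
    have h₁ : (k : ℝ) * θ = (k + 1) * θ - θ := by ring
    have h₂ : ((k : ℝ) + 1 + 1) * θ = (k + 1) * θ + θ := by ring
    rw [h₁, h₂, sin_sub, cos_add]
    linear_combination sin θ * sin_sq_add_cos_sq (((k : ℝ) + 1) * θ)

/-- At an `ε`-root, `sin (nθ) = -ε √2 sin ((n+1)θ)`. -/
theorem IsRoot.sin_eq {n : ℕ} {ε θ : ℝ} (h : IsRoot n ε θ) (hε : ε = 1 ∨ ε = -1) :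
    sin (n * θ) = -(ε * √2 * sin ((n + 1) * θ)) := by
  have hs : √(2 / 3) = √2 * √(1 / 3) := by
    rw [← sqrt_mul (by norm_num)]
    norm_num
  have h3 : √(1 / 3) ≠ 0 := by positivity
  have hε2 : ε ^ 2 = 1 := by rcases hε with rfl | rfl <;> norm_num
  rw [IsRoot, hs] at h
  apply mul_left_cancel₀ h3
  linear_combination ε * h - √(1 / 3) * sin (n * θ) * hε2

/-- If `θ ∈ (0, π)` is an `ε`-root, then
`∑_{i=1}^{n} sin²(iθ) = (1/2)·(n + ε·√2·sin(2(n+1)θ)/(2sinθ))`. -/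
theorem stmt15 (n : ℕ) (hn : 0 < n) (ε : ℝ) (hε : ε = 1 ∨ ε = -1)
    (θ : ℝ) (hθ : θ ∈ Set.Ioo 0 π) (hroot : IsRoot n ε θ) :
    ∑ i ∈ Finset.Icc 1 n, Real.sin (i * θ) ^ 2 =
      (1/2) * (n + ε * Real.sqrt 2 * Real.sin (2 * (n+1) * θ) / (2 * Real.sin θ)) := by
  have hsin : sin θ ≠ 0 := (sin_pos_of_mem_Ioo hθ).ne'
  have hdouble : sin (2 * (n + 1) * θ) = 2 * sin ((n + 1) * θ) * cos ((n + 1) * θ) := by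
    rw [← sin_two_mul, mul_assoc]
  have hsum := two_mul_sin_mul_sum_sin_sq n θ
  rw [hroot.sin_eq hε] at hsum
  rw [hdouble]
  generalize sin ((n + 1) * θ) = s at *
  generalize cos ((n + 1) * θ) = c at *
  field_simp
  linear_combination hsum
end

section
/- Let θ₀ = arctan(√3/(√2−1)). There exists an integer N such that for all n ≥ N: whenever θ ∈ (π/3, 2π/3) is an ε-root and θ' ∈ (0, π) is an ε'-root with θ' ≠ θ (for any signs ε, ε' ∈ {+1, −1}), one has |arccos((2√2/3)·cosθ) − arccos((2√2/3)·cosθ')| ≥ √(6/7) · (π − 2θ₀)/n. -/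
open Real

/-- Polar form of the root condition: `(√2 cos θ + ε, √2 sin θ)` is a multiple `T` of
`(cos nθ, -sin nθ)`. -/
lemma IsRoot.exists_polar {n : ℕ} {ε θ : ℝ} (h : IsRoot n ε θ) :
    ∃ T : ℝ, √2 * cos θ + ε = T * cos (n * θ) ∧ √2 * sin θ = -(T * sin (n * θ)) := by
  unfold IsRoot at h
  have h3 : √(1 / 3 : ℝ) ≠ 0 := by positivity
  have h23 : √(2 / 3 : ℝ) = √2 * √(1 / 3) := by
    rw [← Real.sqrt_mul (by norm_num)]; norm_num
  rw [h23, add_mul, one_mul, sin_add] at h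
  have key : (√2 * cos θ + ε) * sin (n * θ) + √2 * sin θ * cos (n * θ) = 0 := by
    refine (mul_eq_zero.1 (?_ : √(1 / 3 : ℝ) * _ = 0)).resolve_left h3
    linear_combination h
  have hsc := sin_sq_add_cos_sq (n * θ)
  refine ⟨(√2 * cos θ + ε) * cos (n * θ) - √2 * sin θ * sin (n * θ), ?_, ?_⟩
  · linear_combination sin (n * θ) * key - (√2 * cos θ + ε) * hsc
  · linear_combination cos (n * θ) * key - √2 * sin θ * hsc

lemma IsRoot.sq_wronskian {n : ℕ} {ε ε' θ θ' : ℝ} (h : IsRoot n ε θ) (h' : IsRoot n ε' θ')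
    (hε : ε ^ 2 = 1) (hε' : ε' ^ 2 = 1) :
    (2 * sin (θ' - θ) + √2 * (ε * sin θ' - ε' * sin θ)) ^ 2 =
      (3 + 2 * √2 * ε * cos θ) * (3 + 2 * √2 * ε' * cos θ') * sin (n * (θ' - θ)) ^ 2 := by
  obtain ⟨T, hA, hB⟩ := h.exists_polar
  obtain ⟨T', hA', hB'⟩ := h'.exists_polar
  have h2 : √2 ^ 2 = (2 : ℝ) := Real.sq_sqrt (by norm_num)
  have hT : 3 + 2 * √2 * ε * cos θ = T ^ 2 := by
    have e1 : (√2 * cos θ + ε) ^ 2 + (√2 * sin θ) ^ 2 = T ^ 2 := by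
      rw [hA, hB]; linear_combination T ^ 2 * sin_sq_add_cos_sq (n * θ)
    linear_combination e1 - √2 ^ 2 * sin_sq_add_cos_sq θ - h2 - hε
  have hT' : 3 + 2 * √2 * ε' * cos θ' = T' ^ 2 := by
    have e1 : (√2 * cos θ' + ε') ^ 2 + (√2 * sin θ') ^ 2 = T' ^ 2 := by
      rw [hA', hB']; linear_combination T' ^ 2 * sin_sq_add_cos_sq (n * θ')
    linear_combination e1 - √2 ^ 2 * sin_sq_add_cos_sq θ' - h2 - hε'
  have hW : 2 * sin (θ' - θ) + √2 * (ε * sin θ' - ε' * sin θ) =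
      -(T * T' * sin (n * (θ' - θ))) := by
    have e1 : (√2 * cos θ + ε) * (√2 * sin θ') - (√2 * cos θ' + ε') * (√2 * sin θ) =
        -(T * T' * sin (n * (θ' - θ))) := by
      rw [hA, hB, hA', hB', mul_sub, sin_sub]; ring
    rw [← e1, sin_sub]
    linear_combination -(sin θ' * cos θ - cos θ' * sin θ) * h2
  rw [hT, hT', hW]; ring

lemma sqrt_two_bounds : 1.4142 < √2 ∧ √2 < 1.4143 :=
  ⟨Real.lt_sqrt_of_sq_lt (by norm_num), (Real.sqrt_lt' (by norm_num)).2 (by norm_num)⟩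

lemma sin_gt_of_mem_Ioo {θ : ℝ} (h : θ ∈ Set.Ioo (π / 3) (2 * π / 3)) :
    0.866 < sin θ := by
  obtain ⟨h1, h2⟩ := h
  have hc1 : cos θ < 1 / 2 := by
    rw [← cos_pi_div_three]
    exact cos_lt_cos_of_nonneg_of_le_pi (by positivity) (by linarith [pi_pos]) h1
  have hc2 : -(1 / 2) < cos θ := by
    rw [← cos_pi_div_three, ← cos_pi_sub]
    exact cos_lt_cos_of_nonneg_of_le_pi (by linarith [pi_pos]) (by linarith [pi_pos])
      (by linarith)
  have hs : 0 < sin θ := sin_pos_of_pos_of_lt_pi (by linarith [pi_pos]) (by linarith [pi_pos])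
  nlinarith [sin_sq_add_cos_sq θ]

/-- Distinct roots of the same sign are separated by `3/(5n)`. -/
lemma IsRoot.le_mul_abs_sub_of_same_sign {n : ℕ} (hn : 1000 ≤ n) {ε θ θ' : ℝ}
    (hε : ε = 1 ∨ ε = -1) (h : IsRoot n ε θ) (h' : IsRoot n ε θ') (hne : θ' ≠ θ) :
    3 / 5 ≤ n * |θ' - θ| := by
  by_contra! hlt
  have hn' : (1000 : ℝ) ≤ n := by exact_mod_cast hn
  have hε2 : ε ^ 2 = 1 := by rcases hε with rfl | rfl <;> norm_num
  have hεa : |ε| = 1 := by rcases hε with rfl | rfl <;> norm_num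
  have hd : 0 < |θ' - θ| := abs_pos.2 (sub_ne_zero.2 hne)
  have hW := h.sq_wronskian h' hε2 hε2
  obtain ⟨w1, w2⟩ := sqrt_two_bounds
  have hR : ∀ x : ℝ, 0.17 ≤ 3 + 2 * √2 * ε * cos x := fun x => by
    have : |ε * cos x| ≤ 1 := by rw [abs_mul, hεa, one_mul]; exact abs_cos_le_one x
    have := (abs_le.1 this).1
    nlinarith
  have hup : |2 * sin (θ' - θ) + √2 * (ε * sin θ' - ε * sin θ)| ≤ 4 * |θ' - θ| := by
    have e1 : |sin (θ' - θ)| ≤ |θ' - θ| := abs_sin_le_abs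
    have e2 : |ε * sin θ' - ε * sin θ| ≤ |θ' - θ| := by
      rw [← mul_sub, abs_mul, hεa, one_mul]; exact abs_sin_sub_sin_le _ _
    calc _ ≤ |2 * sin (θ' - θ)| + |√2 * (ε * sin θ' - ε * sin θ)| := abs_add_le _ _
      _ = 2 * |sin (θ' - θ)| + √2 * |ε * sin θ' - ε * sin θ| := by
        rw [abs_mul, abs_mul, abs_of_nonneg (Real.sqrt_nonneg 2), abs_two]
      _ ≤ 4 * |θ' - θ| := by nlinarith
  have hsin : n * |θ' - θ| / 2 ≤ |sin (n * (θ' - θ))| := by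
    have e1 := mul_abs_le_abs_sin (x := n * (θ' - θ)) (by
      rw [abs_mul, Nat.abs_cast]; linarith [pi_gt_three])
    rw [abs_mul, Nat.abs_cast] at e1
    have e2 : 1 / 2 ≤ 2 / π := by
      rw [div_le_div_iff₀ two_pos pi_pos]; linarith [pi_lt_four]
    nlinarith [mul_nonneg (Nat.cast_nonneg (α := ℝ) n) hd.le]
  have hsq : (500 * |θ' - θ|) ^ 2 ≤ sin (n * (θ' - θ)) ^ 2 := by
    rw [← sq_abs (sin _)]
    exact pow_le_pow_left₀ (by positivity) (by nlinarith) 2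
  have hup2 := pow_le_pow_left₀ (abs_nonneg _) hup 2
  rw [sq_abs, hW] at hup2
  have hRR : 0.17 * 0.17 ≤ (3 + 2 * √2 * ε * cos θ) * (3 + 2 * √2 * ε * cos θ') :=
    mul_le_mul (hR θ) (hR θ') (by norm_num) (by linarith [hR θ])
  have := mul_le_mul hRR hsq (by positivity) (by linarith)
  nlinarith [pow_pos hd 2]

/-- Roots of opposite sign, one of which lies in `(π/3, 2π/3)`, are separated by `3/(5n)`. -/
lemma IsRoot.le_mul_abs_sub_of_opposite_sign {n : ℕ} (hn : 1000 ≤ n) {ε θ θ' : ℝ}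
    (hε : ε = 1 ∨ ε = -1) (h : IsRoot n ε θ) (h' : IsRoot n (-ε) θ')
    (hθ : θ ∈ Set.Ioo (π / 3) (2 * π / 3)) :
    3 / 5 ≤ n * |θ' - θ| := by
  by_contra! hlt
  have hn' : (1000 : ℝ) ≤ n := by exact_mod_cast hn
  have hε2 : ε ^ 2 = 1 := by rcases hε with rfl | rfl <;> norm_num
  have hεa : |ε| = 1 := by rcases hε with rfl | rfl <;> norm_num
  have hd : 0 ≤ |θ' - θ| := abs_nonneg _
  have hd2 : |θ' - θ| ≤ 1 / 1000 := by nlinarith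
  have hW := h.sq_wronskian h' hε2 (by rw [neg_sq, hε2])
  obtain ⟨w1, w2⟩ := sqrt_two_bounds
  have hs := sin_gt_of_mem_Ioo hθ
  have e1 : |sin (θ' - θ)| ≤ |θ' - θ| := abs_sin_le_abs
  have e2 : 1.73 ≤ sin θ' + sin θ := by
    have := (abs_le.1 (abs_sin_sub_sin_le θ' θ)).1
    linarith
  have hlow : 2.4 ≤ |2 * sin (θ' - θ) + √2 * (ε * sin θ' - -ε * sin θ)| := by
    have e3 : |√2 * (ε * sin θ' - -ε * sin θ)| = √2 * (sin θ' + sin θ) := by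
      rw [show √2 * (ε * sin θ' - -ε * sin θ) = ε * (√2 * (sin θ' + sin θ)) by ring, abs_mul,
        hεa, one_mul, abs_of_nonneg (by nlinarith)]
    have e4 := abs_sub_abs_le_abs_add (√2 * (ε * sin θ' - -ε * sin θ)) (2 * sin (θ' - θ))
    rw [e3, abs_mul, abs_two, add_comm (√2 * _)] at e4
    nlinarith
  have hlow2 := pow_le_pow_left₀ (by norm_num) hlow 2
  rw [sq_abs, hW] at hlow2
  have hRR : (3 + 2 * √2 * ε * cos θ) * (3 + 2 * √2 * -ε * cos θ') ≤ 3.01 ^ 2 := by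
    have e5 : |√2 * ε * (cos θ - cos θ')| ≤ 0.01 := by
      have := abs_cos_sub_cos_le θ θ'
      rw [abs_sub_comm θ θ'] at this
      rw [abs_mul, abs_mul, hεa, mul_one, abs_of_nonneg (Real.sqrt_nonneg 2)]
      nlinarith [abs_nonneg (cos θ - cos θ')]
    obtain ⟨e6, e7⟩ := abs_le.1 e5
    nlinarith [sq_nonneg (√2 * ε * (cos θ + cos θ'))]
  have hsq : sin (n * (θ' - θ)) ^ 2 ≤ 0.6 ^ 2 := by
    rw [← sq_abs (sin _)]
    refine pow_le_pow_left₀ (abs_nonneg _) (abs_sin_le_abs.trans ?_) 2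
    rw [abs_mul, Nat.abs_cast]; linarith
  have := mul_le_mul_of_nonneg_right hRR (sq_nonneg (sin (n * (θ' - θ))))
  nlinarith

lemma mul_le_abs_cos_sub_cos {θ θ' h : ℝ} (hθ : θ ∈ Set.Ioo (π / 3) (2 * π / 3))
    (hθ' : θ' ∈ Set.Ioo 0 π) (h0 : 0 ≤ h) (h1 : h ≤ 1 / 1000) (hd : h ≤ |θ' - θ|) :
    0.865 * h ≤ |cos θ - cos θ'| := by
  have hs := sin_gt_of_mem_Ioo hθ
  obtain ⟨t1, t2⟩ := hθ
  obtain ⟨t3, t4⟩ := hθ'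
  have hsin : h - h ^ 3 / 4 ≤ sin h := by
    rcases h0.eq_or_lt with rfl | hp
    · simp
    · linarith [sin_gt_sub_cube hp, pow_pos hp 3]
  have hsin' : 0.9999 * h ≤ sin h := by
    nlinarith [mul_nonneg h0 h0, mul_nonneg h0 (mul_nonneg h0 h0)]
  have hcos := one_sub_sq_div_two_le_cos (x := h)
  have hcos1 := cos_le_one h
  have hb : |(1 - cos h) * cos θ| ≤ h ^ 2 / 2 := by
    rw [abs_mul, abs_of_nonneg (by linarith : 0 ≤ 1 - cos h)]
    nlinarith [abs_cos_le_one θ, abs_nonneg (cos θ)]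
  obtain ⟨hb1, hb2⟩ := abs_le.1 hb
  have hss : 0.866 * (0.9999 * h) ≤ sin θ * sin h :=
    mul_le_mul hs.le hsin' (by positivity) (by linarith)
  rcases le_abs.1 hd with hd | hd
  · have := cos_le_cos_of_nonneg_of_le_pi (x := θ + h) (y := θ') (by linarith [pi_pos]) t4.le
      (by linarith)
    rw [cos_add] at this
    refine le_trans ?_ (le_abs_self _)
    nlinarith
  · have := cos_le_cos_of_nonneg_of_le_pi (x := θ') (y := θ - h) t3.le (by linarith [pi_pos])
      (by linarith)
    rw [cos_sub] at this
    rw [abs_sub_comm]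
    refine le_trans ?_ (le_abs_self _)
    nlinarith

lemma abs_sub_le_abs_arccos_sub {x y : ℝ} (hx : |x| ≤ 1) (hy : |y| ≤ 1) :
    |x - y| ≤ |arccos x - arccos y| := by
  have := abs_cos_sub_cos_le (arccos x) (arccos y)
  rwa [cos_arccos (abs_le.1 hx).1 (abs_le.1 hx).2,
    cos_arccos (abs_le.1 hy).1 (abs_le.1 hy).2] at this

lemma gap_constant_le : √(6 / 7) * (π - 2 * arctan (√3 / (√2 - 1))) ≤ 0.46 := by
  obtain ⟨w1, w2⟩ := sqrt_two_bounds
  have h3 : 1.732 < √3 := Real.lt_sqrt_of_sq_lt (by norm_num)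
  have h67 : √(6 / 7 : ℝ) < 0.93 := (Real.sqrt_lt' (by norm_num)).2 (by norm_num)
  have hx : 0 < √3 / (√2 - 1) := div_pos (by linarith) (by linarith)
  have hinv := arctan_inv_of_pos hx
  rw [inv_div] at hinv
  have hle : arctan ((√2 - 1) / √3) ≤ (√2 - 1) / √3 := by
    have hpos : 0 < (√2 - 1) / √3 := div_pos (by linarith) (by linarith)
    have := lt_tan (arctan_pos.2 hpos) (arctan_lt_pi_div_two _)
    rw [tan_arctan] at this
    exact this.le
  have hq : (√2 - 1) / √3 ≤ 0.24 := by
    rw [div_le_iff₀ (by linarith)]; linarith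
  have hb : π - 2 * arctan (√3 / (√2 - 1)) ≤ 0.48 := by linarith
  nlinarith [Real.sqrt_nonneg (6 / 7 : ℝ)]

/-- Gap of eigenvalue angles: for large `n`, if `θ ∈ (π/3, 2π/3)` is an `ε`-root and
`θ' ∈ (0, π)` is an `ε'`-root with `θ' ≠ θ`, then
`|arccos((2√2/3)cosθ) − arccos((2√2/3)cosθ')| ≥ √(6/7)·(π − 2θ₀)/n`, where
`θ₀ = arctan(√3/(√2−1))`. -/
theorem stmt16 :
    ∃ N : ℤ, ∀ n : ℕ, N ≤ (n : ℤ) →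
      ∀ ε ε' : ℝ, (ε = 1 ∨ ε = -1) → (ε' = 1 ∨ ε' = -1) →
        ∀ θ θ' : ℝ, θ ∈ Set.Ioo (π/3) (2*π/3) → IsRoot n ε θ →
          θ' ∈ Set.Ioo 0 π → IsRoot n ε' θ' → θ' ≠ θ →
            |Real.arccos ((2 * Real.sqrt 2 / 3) * Real.cos θ) -
                Real.arccos ((2 * Real.sqrt 2 / 3) * Real.cos θ')| ≥
              Real.sqrt (6/7) *
                (π - 2 * Real.arctan (Real.sqrt 3 / (Real.sqrt 2 - 1))) / n := by
  refine ⟨1000, fun n hn ε ε' hε hε' θ θ' hθ h hθ' h' hne => ?_⟩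
  have hn : 1000 ≤ n := by exact_mod_cast hn
  have hnR : (1000 : ℝ) ≤ n := by exact_mod_cast hn
  have hn0 : (0 : ℝ) < n := by linarith
  have hsep : 3 / 5 ≤ n * |θ' - θ| := by
    have hcases : ε' = ε ∨ ε' = -ε := by
      rcases hε with rfl | rfl <;> rcases hε' with rfl | rfl <;> norm_num
    rcases hcases with rfl | rfl
    · exact h.le_mul_abs_sub_of_same_sign hn hε h' hne
    · exact h.le_mul_abs_sub_of_opposite_sign hn hε h' hθ
  obtain ⟨w1, w2⟩ := sqrt_two_bounds
  have hc : ∀ x : ℝ, |2 * √2 / 3 * cos x| ≤ 1 := fun x => by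
    rw [abs_mul, abs_of_nonneg (by positivity : 0 ≤ 2 * √2 / 3)]
    nlinarith [abs_cos_le_one x, abs_nonneg (cos x)]
  have hcos : 0.865 * (3 / 5 / n) ≤ |cos θ - cos θ'| := by
    refine mul_le_abs_cos_sub_cos hθ hθ' (by positivity) ?_ ?_
    · rw [div_le_iff₀ hn0]; linarith
    · rwa [div_le_iff₀' hn0]
  refine le_trans ?_ (abs_sub_le_abs_arccos_sub (hc θ) (hc θ'))
  rw [← mul_sub, abs_mul, abs_of_nonneg (by positivity : 0 ≤ 2 * √2 / 3)]
  calc _ ≤ 0.46 / (n : ℝ) := by gcongr; exact gap_constant_le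
    _ ≤ 0.94 * (0.865 * (3 / 5 / n)) := by
      rw [div_le_iff₀ hn0]; field_simp; norm_num
    _ ≤ _ := mul_le_mul (by linarith) hcos (by positivity) (by positivity)
end

section
/- For every positive integer n and every θ ∈ [π/3, 2π/3], setting λ = (2√2/3)·cosθ, one has n + √2·sin(2(n+1)θ)/(2·sinθ) > 0 and (1/3) · (sin²θ/(1 − λ²)) · ( n + √2·sin(2(n+1)θ)/(2·sinθ) )^{−1} ≥ (9/28) / (n + √(2/3)). -/
open Real

/-- On `[π/3, 2π/3]` the cosine is at most `1/2` in absolute value. -/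
theorem abs_cos_le_half_of_mem_Icc {θ : ℝ} (hθ : θ ∈ Set.Icc (π / 3) (2 * π / 3)) :
    |Real.cos θ| ≤ 1 / 2 := by
  obtain ⟨h₁, h₂⟩ := hθ
  have hpi := Real.pi_pos
  rw [abs_le]
  constructor
  · have h := Real.cos_le_cos_of_nonneg_of_le_pi (x := π / 3) (y := π - θ)
      (by linarith) (by linarith) (by linarith)
    rw [Real.cos_pi_sub, Real.cos_pi_div_three] at h
    linarith
  · have h := Real.cos_le_cos_of_nonneg_of_le_pi (x := π / 3) (y := θ)
      (by linarith) (by linarith) h₁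
    rwa [Real.cos_pi_div_three] at h

/-- If `3/4 ≤ s²` with `s > 0` and `|t| ≤ 1`, then `|√2 t / (2 s)| ≤ √(2/3)`. -/
theorem abs_sqrt_two_mul_div_le {s t : ℝ} (hs : 0 < s) (hs2 : 3 / 4 ≤ s ^ 2) (ht : |t| ≤ 1) :
    |√2 * t / (2 * s)| ≤ √(2 / 3) := by
  apply Real.abs_le_sqrt
  have ht2 : t ^ 2 ≤ 1 := (sq_le_one_iff_abs_le_one t).2 ht
  rw [div_pow, mul_pow, Real.sq_sqrt zero_le_two, div_le_iff₀ (by positivity)]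
  nlinarith

/-- For every positive `n` and `θ ∈ [π/3, 2π/3]`, with `λ = (2√2/3)·cosθ`:
`n + √2·sin(2(n+1)θ)/(2sinθ) > 0` and
`(1/3)·(sin²θ/(1−λ²))·(n + √2·sin(2(n+1)θ)/(2sinθ))⁻¹ ≥ (9/28)/(n + √(2/3))`. -/
theorem stmt17 (n : ℕ) (hn : 0 < n) (θ : ℝ) (hθ : θ ∈ Set.Icc (π/3) (2*π/3)) :
    0 < (n : ℝ) + Real.sqrt 2 * Real.sin (2 * (n+1) * θ) / (2 * Real.sin θ) ∧
    (1/3) * (Real.sin θ ^ 2 / (1 - ((2 * Real.sqrt 2 / 3) * Real.cos θ) ^ 2)) *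
        ((n : ℝ) + Real.sqrt 2 * Real.sin (2 * (n+1) * θ) / (2 * Real.sin θ))⁻¹ ≥
      (9/28) / ((n : ℝ) + Real.sqrt (2/3)) := by
  have hcos := abs_cos_le_half_of_mem_Icc hθ
  have hs : 0 < Real.sin θ :=
    Real.sin_pos_of_pos_of_lt_pi (by linarith [hθ.1, Real.pi_pos]) (by linarith [hθ.2, Real.pi_pos])
  have hc2 : Real.cos θ ^ 2 ≤ 1 / 4 := by
    have h := sq_le_sq' (abs_le.1 hcos).1 (abs_le.1 hcos).2
    linarith
  have hsc := Real.sin_sq_add_cos_sq θ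
  have hr : √(2 / 3 : ℝ) < 1 := by
    rw [Real.sqrt_lt' one_pos]
    norm_num
  have hn1 : (1 : ℝ) ≤ n := by exact_mod_cast hn
  have hb := abs_le.1 (abs_sqrt_two_mul_div_le hs (by linarith)
    (Real.abs_sin_le_one (2 * (n + 1) * θ)))
  have hpos : 0 < (n : ℝ) + √2 * Real.sin (2 * (n + 1) * θ) / (2 * Real.sin θ) := by
    linarith [hb.1]
  refine ⟨hpos, ?_⟩
  have hcoef : 9 / 28 ≤
      (1 / 3) * (Real.sin θ ^ 2 / (1 - ((2 * √2 / 3) * Real.cos θ) ^ 2)) := by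
    have hl : ((2 * √2 / 3) * Real.cos θ) ^ 2 = 8 / 9 * Real.cos θ ^ 2 := by
      rw [mul_pow, div_pow, mul_pow, Real.sq_sqrt zero_le_two]
      norm_num
    have h : 27 / 28 ≤ Real.sin θ ^ 2 / (1 - 8 / 9 * Real.cos θ ^ 2) := by
      rw [le_div_iff₀ (by linarith)]
      linarith
    rw [hl]
    linarith
  rw [ge_iff_le, div_eq_mul_inv]
  gcongr
  exact hb.2
end

section
/- Define the (4n+2)×(2n+2) real matrix A, with rows indexed 1, …, 4n+2 and columns indexed 1, …, 2n+2, by: A(1,1) = 1; A(2j−2, j) = √p and A(2j−1, j) = √q for 2 ≤ j ≤ n+1; A(i, j) = A(4n+3−i, 2n+3−j) for all i, j with j ≥ n+2 (centrosymmetry); and all other entries zero. Then: (i) Aᵀ·A = I_{2n+2}; (ii) M_C = 2·A·Aᵀ − I_{4n+2}; and (iii) Aᵀ·M_S·A = J. -/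
open Matrix

/-- Entries of the left half of the matrix `A` (0-indexed): column `0` is the standard
basis vector `e_0`; column `c` for `1 ≤ c ≤ n` has `√p` at row `2c−1` and `√q` at
row `2c`, with `p = 1/3`, `q = 2/3`. -/
noncomputable def Ahalf (i c : ℕ) : ℝ :=
  if c = 0 then (if i = 0 then 1 else 0)
  else if i = 2*c - 1 then Real.sqrt (1/3)
  else if i = 2*c then Real.sqrt (2/3)
  else 0

/-- The `(4n+2)×(2n+2)` centrosymmetric matrix `A` (0-indexed): for columns
`j ≤ n` the entries are `Ahalf`, and for columns `j ≥ n+1` they are obtained by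
centrosymmetry `A(i,j) = A(4n+1−i, 2n+1−j)`. -/
noncomputable def Amat (n : ℕ) : Matrix (Fin (4*n+2)) (Fin (2*n+2)) ℝ :=
  Matrix.of fun i j =>
    if j.val ≤ n then Ahalf i.val j.val else Ahalf (4*n+1 - i.val) (2*n+1 - j.val)

/-- The unique nonzero entry of row `i` of `Amat n`, which sits in column `(i + 1) / 2`. -/
noncomputable def rowEntry (n i : ℕ) : ℝ :=
  if i = 0 ∨ i = 4*n+1 then 1
  else if i % 2 = 1 then (if i ≤ 2*n then Real.sqrt (1/3) else Real.sqrt (2/3))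
  else (if i ≤ 2*n then Real.sqrt (2/3) else Real.sqrt (1/3))

lemma Amat_apply (n : ℕ) (i : Fin (4*n+2)) (j : Fin (2*n+2)) :
    Amat n i j = if j.val = (i.val + 1) / 2 then rowEntry n i.val else 0 := by
  obtain ⟨i, hi⟩ := i
  obtain ⟨j, hj⟩ := j
  simp only [Amat, Ahalf, rowEntry, Matrix.of_apply]
  split_ifs <;> first | rfl | omega

/-- A sum over the rows meeting column `j` has at most the two terms `2j - 1` and `2j`. -/
lemma sum_rows_of_column (n j : ℕ) (hj : j < 2*n+2) (f : ℕ → ℝ) :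
    (∑ i : Fin (4*n+2), if j = (i.val + 1) / 2 then f i.val else 0) =
      (if j = 0 then 0 else f (2*j-1)) + (if j = 2*n+1 then 0 else f (2*j)) := by
  rw [Fin.sum_univ_eq_sum_range (fun i => if j = (i + 1) / 2 then f i else 0)]
  have h : ∀ i ∈ Finset.range (4*n+2), (if j = (i + 1) / 2 then f i else 0) =
      (if i = 2*j-1 then (if j = 0 then 0 else f (2*j-1)) else 0) +
        (if i = 2*j then f (2*j) else 0) := by
    intro i _
    split_ifs <;> first | omega | (simp only [add_zero, zero_add]; done) |
      (simp only [add_zero, zero_add]; congr 1)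
  rw [Finset.sum_congr rfl h, Finset.sum_add_distrib, Finset.sum_ite_eq', Finset.sum_ite_eq']
  simp only [Finset.mem_range]
  split_ifs <;> first | rfl | omega

/-- The permutation exchanging `2k` and `2k + 1`. -/
def shiftIndex (i : ℕ) : ℕ := if i % 2 = 0 then i + 1 else i - 1

lemma MS_mul_Amat_apply (n : ℕ) (i : Fin (4*n+2)) (k : Fin (2*n+2)) :
    (MS n * Amat n) i k =
      if k.val = (shiftIndex i.val + 1) / 2 then rowEntry n (shiftIndex i.val) else 0 := by
  have hlt : shiftIndex i.val < 4*n+2 := by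
    have := i.isLt
    unfold shiftIndex
    split_ifs <;> omega
  have h (l : Fin (4*n+2)) : MS n i l = if l = ⟨shiftIndex i.val, hlt⟩ then 1 else 0 := by
    simp only [MS, Matrix.of_apply, ne_eq, Fin.ext_iff, shiftIndex]
    split_ifs <;> first | rfl | omega
  simp only [Matrix.mul_apply, h, ite_mul, one_mul, zero_mul, Finset.sum_ite_eq',
    Finset.mem_univ, if_true, Amat_apply]

lemma Amat_transpose_mul_apply (n : ℕ) (j : Fin (2*n+2)) {m : Type*}
    (B : Matrix (Fin (4*n+2)) m ℝ) (k : m) (f : ℕ → ℝ) (hB : ∀ i, B i k = f i.val) :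
    ((Amat n)ᵀ * B) j k =
      (if j.val = 0 then 0 else rowEntry n (2*j.val-1) * f (2*j.val-1)) +
        (if j.val = 2*n+1 then 0 else rowEntry n (2*j.val) * f (2*j.val)) := by
  rw [← sum_rows_of_column n j j.isLt (fun i => rowEntry n i * f i)]
  simp only [Matrix.mul_apply, Matrix.transpose_apply, Amat_apply, hB, ite_mul, zero_mul]

lemma Amat_mul_transpose_apply (n : ℕ) (i k : Fin (4*n+2)) :
    (Amat n * (Amat n)ᵀ) i k =
      if (i.val + 1) / 2 = (k.val + 1) / 2 then rowEntry n i.val * rowEntry n k.val else 0 := by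
  have hlt : (i.val + 1) / 2 < 2*n+2 := by omega
  have h (j : Fin (2*n+2)) : Amat n i j =
      if j = ⟨(i.val + 1) / 2, hlt⟩ then rowEntry n i.val else 0 := by
    simp only [Amat_apply, Fin.ext_iff]
  simp only [Matrix.mul_apply, Matrix.transpose_apply, h, ite_mul, zero_mul,
    Finset.sum_ite_eq', Finset.mem_univ, if_true]
  simp only [Amat_apply, mul_ite, mul_zero]

lemma sqrt_third_mul_sqrt_two_thirds :
    Real.sqrt (1/3) * Real.sqrt (2/3) = Real.sqrt 2 / 3 := by
  rw [← Real.sqrt_mul (by norm_num), show (1/3 * (2/3) : ℝ) = 2 / 3 ^ 2 by norm_num,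
    Real.sqrt_div (by norm_num), Real.sqrt_sq (by norm_num)]

lemma Amat_transpose_mul_self (n : ℕ) : (Amat n)ᵀ * Amat n = 1 := by
  have hp : Real.sqrt (1/3) * Real.sqrt (1/3) = 1/3 := Real.mul_self_sqrt (by norm_num)
  have hq : Real.sqrt (2/3) * Real.sqrt (2/3) = 2/3 := Real.mul_self_sqrt (by norm_num)
  ext j k
  rw [Amat_transpose_mul_apply n j _ k
    (fun i => if k.val = (i + 1) / 2 then rowEntry n i else 0) (fun i => Amat_apply n i k)]
  obtain ⟨j, hj⟩ := j
  obtain ⟨k, hk⟩ := k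
  simp only [Matrix.one_apply, Fin.mk.injEq]
  by_cases hjk : j = k
  · subst hjk
    rw [if_pos rfl, if_pos (by omega : j = (2*j+1)/2)]
    rcases Nat.eq_zero_or_pos j with rfl | hpos
    · simp [rowEntry]
    · rw [if_neg (by omega), if_pos (by omega : j = (2*j-1+1)/2)]
      simp only [rowEntry]
      split_ifs <;> first | omega | ((try simp only [hp, hq]); norm_num)
  · rw [if_neg hjk, if_neg (by omega : ¬ k = (2*j+1)/2)]
    split_ifs <;> first | omega | simp

lemma MC_eq (n : ℕ) : MC n = (2 : ℝ) • (Amat n * (Amat n)ᵀ) - 1 := by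
  have hp : Real.sqrt (1/3) * Real.sqrt (1/3) = 1/3 := Real.mul_self_sqrt (by norm_num)
  have hq : Real.sqrt (2/3) * Real.sqrt (2/3) = 2/3 := Real.mul_self_sqrt (by norm_num)
  have hpq := sqrt_third_mul_sqrt_two_thirds
  have hqp := (mul_comm (Real.sqrt (2/3)) (Real.sqrt (1/3))).trans hpq
  ext i k
  rw [Matrix.sub_apply, Matrix.smul_apply, Amat_mul_transpose_apply]
  obtain ⟨i, hi⟩ := i
  obtain ⟨k, hk⟩ := k
  simp only [MC, Matrix.of_apply, Matrix.one_apply, Fin.mk.injEq, rowEntry, smul_eq_mul]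
  by_cases hik : i = k
  · subst hik
    simp only [if_true]
    split_ifs <;> first | omega | ((try simp only [hp, hq]); norm_num)
  · simp only [hik, if_false]
    split_ifs <;> first | omega | (simp only [hpq, hqp]; ring) | norm_num

lemma Amat_transpose_mul_MS_mul (n : ℕ) (hn : 0 < n) :
    (Amat n)ᵀ * MS n * Amat n = Jmat n := by
  have hq : Real.sqrt (2/3) * Real.sqrt (2/3) = 2/3 := Real.mul_self_sqrt (by norm_num)
  have hpq : Real.sqrt (1/3 * (2/3)) = Real.sqrt (1/3) * Real.sqrt (2/3) :=
    Real.sqrt_mul (by norm_num) _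
  ext j k
  rw [Matrix.mul_assoc, Amat_transpose_mul_apply n j _ k
    (fun i => if k.val = (shiftIndex i + 1) / 2 then rowEntry n (shiftIndex i) else 0)
    (fun i => MS_mul_Amat_apply n i k)]
  obtain ⟨j, hj⟩ := j
  obtain ⟨k, hk⟩ := k
  have hodd : j ≠ 0 → shiftIndex (2*j-1) = 2*j-2 := by
    intro h
    unfold shiftIndex
    split_ifs <;> omega
  have heven : shiftIndex (2*j) = 2*j+1 := by simp [shiftIndex]
  simp only [Jmat, Matrix.of_apply, heven]
  by_cases hup : j + 1 = k
  · subst hup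
    have h1 : (if j = 0 then 0 else rowEntry n (2*j-1) *
        (if j + 1 = (shiftIndex (2*j-1) + 1) / 2 then rowEntry n (shiftIndex (2*j-1)) else 0))
        = (0 : ℝ) := by
      split_ifs with h h'
      · rfl
      · rw [hodd h] at h'; omega
      · simp
    rw [h1, if_neg (by omega), if_pos (by omega), if_pos rfl, zero_add]
    simp only [rowEntry, Jsuper, hpq]
    split_ifs <;> first | omega | exact hq | ring1 | (simp only [false_or] at *; omega)
  · by_cases hdown : k + 1 = j
    · subst hdown
      rw [hodd (by omega), if_neg (by omega), if_neg hup, if_pos rfl, if_pos (by omega),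
        if_neg (by omega : ¬ k = (2*(k+1)+1+1)/2), mul_zero, ite_self, add_zero]
      simp only [rowEntry, Jsuper, hpq]
      split_ifs <;> first | omega | exact hq | ring1
    · rw [if_neg hup, if_neg hdown, if_neg (by omega : ¬ k = (2*j+1+1)/2), mul_zero, ite_self,
        add_zero]
      split_ifs with h h'
      · rfl
      · rw [hodd h] at h'; omega
      · simp

/-- The matrix `A` satisfies: (i) `Aᵀ·A = I`; (ii) `M_C = 2AAᵀ − I`;
(iii) `Aᵀ·M_S·A = J`. -/
theorem stmt18 (n : ℕ) (hn : 0 < n) :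
    (Amat n)ᵀ * Amat n = 1 ∧
    MC n = (2 : ℝ) • (Amat n * (Amat n)ᵀ) - 1 ∧
    (Amat n)ᵀ * MS n * Amat n = Jmat n := by
  exact ⟨Amat_transpose_mul_self n, MC_eq n, Amat_transpose_mul_MS_mul n hn⟩
end
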